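/- arXiv:2303.07658 — 2 statements merged into one kernel-verified Lean document; each statement's English description precedes it below -/
import Mathlib

section
/- Let n ≥ 5 and 3 ≤ i ≤ n-1. Then Σ_{σ ∈ D_n^{{0,1,i}}} (-1)^{ℓ(σ)} x^{L(σ)} = (1 - x^4) ∏_{j=5}^{n} (1 + (-1)^{j-1} x^{⌊j/2⌋})^2. -/
open Polynomial Finset

namespace OddLength

/-- A signed permutation of degree `n`, encoded as an underlying permutation of
`Fin n` together with a sign vector. -/
abbrev SP (n : ℕ) := Equiv.Perm (Fin n) × (Fin n → Bool)

/-- The one-line value `σ(i)` of a signed permutation, for `i ∈ [1,n]` (and `0` elsewhere). -/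
def sval {n : ℕ} (σ : SP n) (i : ℕ) : ℤ :=
  if h : 1 ≤ i ∧ i ≤ n then
    (if σ.2 ⟨i - 1, by omega⟩ then (-1 : ℤ) else 1) *
      (((σ.1 ⟨i - 1, by omega⟩ : Fin n) : ℕ) + 1 : ℤ)
  else 0

/-- A signed permutation is *even* (lies in the Weyl group `D_n`) if it has an even
number of negative entries in its one-line notation. -/
def IsEvenSP {n : ℕ} (σ : SP n) : Prop :=
  Even ((Finset.univ.filter (fun i => σ.2 i = true)).card)

instance {n : ℕ} (σ : SP n) : Decidable (IsEvenSP σ) := by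
  unfold IsEvenSP; infer_instance

/-- Pairs `1 ≤ i < j ≤ n` of positions. -/
def pairs (n : ℕ) : Finset (ℕ × ℕ) :=
  (Finset.Icc 1 n ×ˢ Finset.Icc 1 n).filter (fun p => p.1 < p.2)

/-- Number of inversions. -/
def invSP {n : ℕ} (σ : SP n) : ℕ :=
  ((pairs n).filter (fun p => sval σ p.2 < sval σ p.1)).card

/-- Number of negative sum pairs. -/
def nspSP {n : ℕ} (σ : SP n) : ℕ :=
  ((pairs n).filter (fun p => sval σ p.1 + sval σ p.2 < 0)).card

/-- Number of odd inversions (positions of different parity). -/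
def oinvSP {n : ℕ} (σ : SP n) : ℕ :=
  ((pairs n).filter (fun p => sval σ p.2 < sval σ p.1 ∧ p.1 % 2 ≠ p.2 % 2)).card

/-- Number of odd negative sum pairs (positions of different parity). -/
def onspSP {n : ℕ} (σ : SP n) : ℕ :=
  ((pairs n).filter (fun p => sval σ p.1 + sval σ p.2 < 0 ∧ p.1 % 2 ≠ p.2 % 2)).card

/-- The type-`D` Coxeter length `ℓ(σ) = inv(σ) + nsp(σ)`. -/
def ellD {n : ℕ} (σ : SP n) : ℕ := invSP σ + nspSP σ

/-- The type-`D` odd length `L(σ) = oinv(σ) + onsp(σ)`. -/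
def LD {n : ℕ} (σ : SP n) : ℕ := oinvSP σ + onspSP σ

/-- The descent value at position `i`, with the type-`D` convention `σ(0) := -σ(2)`. -/
def dval {n : ℕ} (σ : SP n) (i : ℕ) : ℤ := if i = 0 then -sval σ 2 else sval σ i

/-- Membership in the parabolic quotient `D_n^I`: `σ(i) < σ(i+1)` for all `i ∈ I`,
with the convention `σ(0) = -σ(2)`. -/
def InQuot {n : ℕ} (σ : SP n) (I : Finset ℕ) : Prop :=
  ∀ i ∈ I, dval σ i < dval σ (i + 1)

instance {n : ℕ} (σ : SP n) (I : Finset ℕ) : Decidable (InQuot σ I) := by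
  unfold InQuot; infer_instance

/-- `σ` is ascending: `σ(1) < σ(2) < ⋯ < σ(n)`. -/
def Ascending {n : ℕ} (σ : SP n) : Prop :=
  ∀ i, 1 ≤ i → i < n → sval σ i < sval σ (i + 1)

/-- `σ` is a chessboard element: `σ(i) ≢ σ(i+1) (mod 2)` for all `i ∈ [n-1]`. -/
def Chessboard {n : ℕ} (σ : SP n) : Prop :=
  ∀ i ∈ Finset.Icc 1 (n - 1), sval σ i % 2 ≠ sval σ (i + 1) % 2

instance {n : ℕ} (σ : SP n) : Decidable (Chessboard σ) := by
  unfold Chessboard; infer_instance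

/-- The sign-twisted generating function of the odd length over `D_n^I`. -/
noncomputable def genD (n : ℕ) (I : Finset ℕ) : Polynomial ℤ :=
  ∑ σ ∈ Finset.univ.filter (fun σ : SP n => IsEvenSP σ ∧ InQuot σ I),
    (-1 : Polynomial ℤ) ^ ellD σ * X ^ LD σ



/-- Base of the weight attached to a pair of positions with the given letters. -/
noncomputable def yv (a b : Bool) : Polynomial ℤ := if a = b then -1 else -X

/-- Number of inversions plus number of negative sums of a pair of values. -/
def cc (a b : ℤ) : ℕ := (if b < a then 1 else 0) + (if a + b < 0 then 1 else 0)

/-- Signed value at a position in `Fin n`. -/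
def vv {n : ℕ} (σ : SP n) (p : Fin n) : ℤ :=
  (if σ.2 p then (-1 : ℤ) else 1) * (((σ.1 p : Fin n) : ℕ) + 1 : ℤ)

/-- Weight of a signed permutation with respect to a letter assignment. -/
noncomputable def W {n : ℕ} (ε : Fin n → Bool) (σ : SP n) : Polynomial ℤ :=
  ∏ r ∈ (Finset.univ : Finset (Fin n × Fin n)).filter (fun r => r.1 < r.2),
    yv (ε r.1) (ε r.2) ^ cc (vv σ r.1) (vv σ r.2)

open Classical in
/-- Constrained sum of weights. -/
noncomputable def S {n : ℕ} (ε : Fin n → Bool) (P : SP n → Prop) : Polynomial ℤ :=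
  ∑ σ : SP n, if P σ then W ε σ else 0

theorem yv_comm (a b : Bool) : yv a b = yv b a := by
  unfold yv; simp only [eq_comm]

theorem vv_abs {n : ℕ} (σ : SP n) (p : Fin n) : |vv σ p| = ((σ.1 p : ℕ) : ℤ) + 1 := by
  unfold vv
  split_ifs
  · rw [neg_one_mul, abs_neg, abs_of_nonneg (by positivity)]
  · rw [one_mul, abs_of_nonneg (by positivity)]

theorem vv_abs_ne {n : ℕ} (σ : SP n) {p q : Fin n} (h : p ≠ q) : |vv σ p| ≠ |vv σ q| := by
  rw [vv_abs, vv_abs]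
  intro h'
  apply h
  apply σ.1.injective
  apply Fin.ext
  omega

theorem vv_ne_zero {n : ℕ} (σ : SP n) (p : Fin n) : vv σ p ≠ 0 := by
  rw [← abs_pos, vv_abs]; positivity

theorem S_congr {n : ℕ} (ε : Fin n → Bool) {P Q : SP n → Prop} (h : ∀ σ, P σ ↔ Q σ) :
    S ε P = S ε Q := by
  have : P = Q := funext fun σ => propext (h σ)
  rw [this]

theorem S_split {n : ℕ} (ε : Fin n → Bool) (P Q : SP n → Prop) :
    S ε P = S ε (fun σ => P σ ∧ Q σ) + S ε (fun σ => P σ ∧ ¬ Q σ) := by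
  unfold S
  rw [← Finset.sum_add_distrib]
  refine Finset.sum_congr rfl fun σ _ => ?_
  by_cases h : P σ <;> by_cases h' : Q σ <;> simp [h, h']

theorem S_transport {n : ℕ} (ε ε' : Fin n → Bool) (P P' : SP n → Prop) (φ : SP n → SP n)
    (hφ : Function.Involutive φ) (k : Polynomial ℤ)
    (hP : ∀ σ, P (φ σ) ↔ P' σ) (hW : ∀ σ, P' σ → W ε (φ σ) = k * W ε' σ) :
    S ε P = k * S ε' P' := by
  unfold S
  rw [Finset.mul_sum, ← Equiv.sum_comp (hφ.toPerm φ)]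
  refine Finset.sum_congr rfl fun σ _ => ?_
  have e : (hφ.toPerm φ) σ = φ σ := rfl
  rw [e]
  by_cases h : P' σ
  · rw [if_pos ((hP σ).2 h), if_pos h, hW σ h]
  · rw [if_neg (fun h' => h ((hP σ).1 h')), if_neg h, mul_zero]

/-- Swap the entries in two positions. -/
def sw {n : ℕ} (i j : Fin n) (σ : SP n) : SP n :=
  ((Equiv.swap i j).trans σ.1, σ.2 ∘ Equiv.swap i j)

/-- Negate the entry in a position. -/
def ng {n : ℕ} (j : Fin n) (σ : SP n) : SP n :=
  (σ.1, Function.update σ.2 j (! σ.2 j))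

theorem sw_invol {n : ℕ} (i j : Fin n) : Function.Involutive (sw i j) := by
  intro σ
  unfold sw
  ext x <;> simp

theorem ng_invol {n : ℕ} (j : Fin n) : Function.Involutive (ng j) := by
  intro σ
  unfold ng
  ext x <;> simp

theorem vv_sw {n : ℕ} (i j : Fin n) (σ : SP n) (p : Fin n) :
    vv (sw i j σ) p = vv σ (Equiv.swap i j p) := rfl

theorem vv_ng_self {n : ℕ} (j : Fin n) (σ : SP n) : vv (ng j σ) j = - vv σ j := by
  unfold vv ng
  cases h : σ.2 j <;> simp

theorem vv_ng_ne {n : ℕ} (j : Fin n) (σ : SP n) {p : Fin n} (h : p ≠ j) :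
    vv (ng j σ) p = vv σ p := by
  unfold vv ng
  simp [h]

/-- The weight without the pair `(i, j)`. -/
noncomputable def R {n : ℕ} (i j : Fin n) (ε : Fin n → Bool) (σ : SP n) : Polynomial ℤ :=
  ∏ r ∈ ((Finset.univ : Finset (Fin n × Fin n)).filter (fun r => r.1 < r.2)).erase (i, j),
    yv (ε r.1) (ε r.2) ^ cc (vv σ r.1) (vv σ r.2)

theorem W_eq {n : ℕ} {i j : Fin n} (h : i < j) (ε : Fin n → Bool) (σ : SP n) :
    W ε σ = yv (ε i) (ε j) ^ cc (vv σ i) (vv σ j) * R i j ε σ := by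
  unfold W R
  rw [Finset.mul_prod_erase _ (fun r : Fin n × Fin n =>
    yv (ε r.1) (ε r.2) ^ cc (vv σ r.1) (vv σ r.2)) (a := (i, j))]
  simpa using h

theorem swap_lt {n : ℕ} {i j : Fin n} (h : (j : ℕ) = i + 1) {p q : Fin n} (hpq : p < q)
    (hne : ¬ (p = i ∧ q = j)) : Equiv.swap i j p < Equiv.swap i j q := by
  simp only [Equiv.swap_apply_def]
  rw [Fin.lt_def] at hpq
  rw [Fin.ext_iff, Fin.ext_iff] at hne
  split_ifs with h1 h2 h3 h4 h5 h6 <;> simp only [Fin.ext_iff] at * <;> rw [Fin.lt_def] <;> omega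

theorem R_sw {n : ℕ} {i j : Fin n} (h : (j : ℕ) = i + 1) (ε : Fin n → Bool) (σ : SP n) :
    R i j ε (sw i j σ) = R i j (ε ∘ Equiv.swap i j) σ := by
  have hij : i < j := by rw [Fin.lt_def]; omega
  have key : ∀ r : Fin n × Fin n,
      r ∈ ((Finset.univ : Finset (Fin n × Fin n)).filter (fun r => r.1 < r.2)).erase (i, j) →
      (Equiv.swap i j r.1, Equiv.swap i j r.2) ∈
      ((Finset.univ : Finset (Fin n × Fin n)).filter (fun r => r.1 < r.2)).erase (i, j) := by
    rintro ⟨p, q⟩ hr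
    simp only [Finset.mem_erase, Finset.mem_filter, Finset.mem_univ, true_and, ne_eq,
      Prod.mk.injEq] at hr ⊢
    refine ⟨?_, swap_lt h hr.2 hr.1⟩
    rintro ⟨h1, h2⟩
    have hp : p = j := by
      have := congrArg (Equiv.swap i j) h1; simpa using this
    have hq : q = i := by
      have := congrArg (Equiv.swap i j) h2; simpa using this
    subst hp hq
    exact absurd hr.2 (not_lt.2 hij.le)
  unfold R
  refine Finset.prod_nbij' (fun r => (Equiv.swap i j r.1, Equiv.swap i j r.2))
    (fun r => (Equiv.swap i j r.1, Equiv.swap i j r.2)) key key ?_ ?_ ?_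
  · intro r _; simp
  · intro r _; simp
  · intro r _; simp [vv_sw]

theorem cc_swap {a b : ℤ} (h : a < b) : cc b a = cc a b + 1 := by
  unfold cc
  rw [if_pos h, if_neg (not_lt.2 h.le), add_comm b a]
  omega

theorem W_sw {n : ℕ} {i j : Fin n} (h : (j : ℕ) = i + 1) (ε : Fin n → Bool) (σ : SP n)
    (ha : vv σ i < vv σ j) :
    W ε (sw i j σ) = yv (ε i) (ε j) * W (ε ∘ Equiv.swap i j) σ := by
  have hij : i < j := by rw [Fin.lt_def]; omega
  rw [W_eq hij, W_eq hij, R_sw h, vv_sw, vv_sw]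
  simp only [Function.comp_apply, Equiv.swap_apply_left, Equiv.swap_apply_right]
  rw [cc_swap ha, yv_comm (ε j), pow_succ]
  ring

/-- Splitting a sum along an ascent condition. -/
theorem S_asc {n : ℕ} {i j : Fin n} (h : (j : ℕ) = i + 1) (ε : Fin n → Bool) (P : SP n → Prop)
    (hP : ∀ σ, P (sw i j σ) ↔ P σ) :
    S ε P = S ε (fun σ => P σ ∧ vv σ i < vv σ j) +
      yv (ε i) (ε j) * S (ε ∘ Equiv.swap i j) (fun σ => P σ ∧ vv σ i < vv σ j) := by
  have hij : i ≠ j := by intro e; rw [e] at h; omega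
  rw [S_split ε P (fun σ => vv σ i < vv σ j)]
  congr 1
  refine S_transport _ _ _ _ (sw i j) (sw_invol i j) _ ?_ ?_
  · intro σ
    rw [hP, vv_sw, vv_sw]
    simp only [Equiv.swap_apply_left, Equiv.swap_apply_right]
    have := vv_abs_ne σ hij
    have h2 : vv σ i ≠ vv σ j := fun e => this (by rw [e])
    constructor
    · rintro ⟨h1, h3⟩; exact ⟨h1, by omega⟩
    · rintro ⟨h1, h3⟩; exact ⟨h1, by omega⟩
  · intro σ hσ
    exact W_sw h ε σ hσ.2

theorem cc_neg_left {a b : ℤ} (h : |a| ≠ |b|) : cc (-a) b = cc a b := by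
  unfold cc
  rcases abs_cases a with ⟨h1, h2⟩ | ⟨h1, h2⟩ <;> rcases abs_cases b with ⟨h3, h4⟩ | ⟨h3, h4⟩ <;>
  rw [h1, h3] at h <;> split_ifs <;> omega

theorem W_ng0 {n : ℕ} (z : Fin n) (hz : (z : ℕ) = 0) (ε : Fin n → Bool) (σ : SP n) :
    W ε (ng z σ) = W ε σ := by
  unfold W
  refine Finset.prod_congr rfl ?_
  rintro ⟨p, q⟩ hr
  simp only [Finset.mem_filter, Finset.mem_univ, true_and] at hr ⊢
  have hq : q ≠ z := by intro e; rw [e, Fin.lt_def] at hr; omega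
  rw [vv_ng_ne z σ hq]
  by_cases hp : p = z
  · subst hp
    rw [vv_ng_self, cc_neg_left (vv_abs_ne σ hr.ne)]
  · rw [vv_ng_ne z σ hp]

theorem W_ng1 {n : ℕ} (z o : Fin n) (hz : (z : ℕ) = 0) (ho : (o : ℕ) = 1) (ε : Fin n → Bool)
    (σ : SP n) (h : |vv σ z| < vv σ o) :
    W ε (ng o σ) = yv (ε z) (ε o) ^ 2 * W ε σ := by
  have hzo : z < o := by rw [Fin.lt_def]; omega
  rw [W_eq hzo, W_eq hzo, vv_ng_self, vv_ng_ne o σ hzo.ne]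
  have h1 : R z o ε (ng o σ) = R z o ε σ := by
    unfold R
    refine Finset.prod_congr rfl ?_
    rintro ⟨p, q⟩ hr
    simp only [Finset.mem_erase, Finset.mem_filter, Finset.mem_univ, true_and, ne_eq,
      Prod.mk.injEq] at hr ⊢
    have hq : q ≠ o := by
      intro e
      apply hr.1
      refine ⟨?_, e⟩
      have := hr.2
      rw [e, Fin.lt_def] at this
      apply Fin.ext; omega
    rw [vv_ng_ne o σ hq]
    by_cases hp : p = o
    · subst hp
      rw [vv_ng_self, cc_neg_left (vv_abs_ne σ hr.2.ne)]
    · rw [vv_ng_ne o σ hp]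
  rw [abs_lt] at h
  have h2 : cc (vv σ z) (- vv σ o) = 2 := by
    unfold cc; rw [if_pos (by omega), if_pos (by omega)]
  have h3 : cc (vv σ z) (vv σ o) = 0 := by
    unfold cc; rw [if_neg (by omega), if_neg (by omega)]
  rw [h1, h2, h3, pow_zero, one_mul]

/-- Splitting a sum along the type `D` condition at the first two positions. -/
theorem S_quot {n : ℕ} {z o : Fin n} (hz : (z : ℕ) = 0) (ho : (o : ℕ) = 1) (ε : Fin n → Bool)
    (P : SP n → Prop) (hP : ∀ σ, P (sw z o σ) ↔ P σ) (hP0 : ∀ σ, P (ng z σ) ↔ P σ)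
    (hP1 : ∀ σ, P (ng o σ) ↔ P σ) :
    S ε P = (1 + yv (ε z) (ε o) ^ 2) * S ε (fun σ => P σ ∧ |vv σ z| < vv σ o) +
      2 * yv (ε z) (ε o) * S (ε ∘ Equiv.swap z o) (fun σ => P σ ∧ |vv σ z| < vv σ o) := by
  have hzo : z ≠ o := by intro e; rw [e] at hz; omega
  rw [S_split ε P (fun σ => |vv σ z| < |vv σ o|),
    S_split ε (fun σ => P σ ∧ |vv σ z| < |vv σ o|) (fun σ => 0 < vv σ o),
    S_split ε (fun σ => P σ ∧ ¬ |vv σ z| < |vv σ o|) (fun σ => 0 < vv σ z)]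
  have e1 : S ε (fun σ => (P σ ∧ |vv σ z| < |vv σ o|) ∧ 0 < vv σ o) =
      S ε (fun σ => P σ ∧ |vv σ z| < vv σ o) := by
    apply S_congr
    intro σ
    constructor
    · rintro ⟨⟨h1, h2⟩, h3⟩
      exact ⟨h1, by rwa [abs_of_pos h3] at h2⟩
    · rintro ⟨h1, h2⟩
      have h3 : 0 < vv σ o := lt_of_le_of_lt (abs_nonneg _) h2
      exact ⟨⟨h1, by rwa [abs_of_pos h3]⟩, h3⟩
  have e2 : S ε (fun σ => (P σ ∧ |vv σ z| < |vv σ o|) ∧ ¬ 0 < vv σ o) =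
      yv (ε z) (ε o) ^ 2 * S ε (fun σ => P σ ∧ |vv σ z| < vv σ o) := by
    refine S_transport _ _ _ _ (ng o) (ng_invol o) _ ?_ ?_
    · intro σ
      rw [hP1, vv_ng_self, vv_ng_ne o σ hzo, abs_neg]
      constructor
      · rintro ⟨⟨h1, h2⟩, h3⟩
        have h4 : 0 ≤ vv σ o := by omega
        exact ⟨h1, by rwa [abs_of_nonneg h4] at h2⟩
      · rintro ⟨h1, h2⟩
        have h3 : 0 < vv σ o := lt_of_le_of_lt (abs_nonneg _) h2
        exact ⟨⟨h1, by rwa [abs_of_pos h3]⟩, by omega⟩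
    · intro σ hσ
      exact W_ng1 z o hz ho ε σ hσ.2
  have e3 : S ε (fun σ => (P σ ∧ ¬ |vv σ z| < |vv σ o|) ∧ 0 < vv σ z) =
      yv (ε z) (ε o) * S (ε ∘ Equiv.swap z o) (fun σ => P σ ∧ |vv σ z| < vv σ o) := by
    refine S_transport _ _ _ _ (sw z o) (sw_invol z o) _ ?_ ?_
    · intro σ
      rw [hP, vv_sw, vv_sw]
      simp only [Equiv.swap_apply_left, Equiv.swap_apply_right]
      have hne := vv_abs_ne σ hzo
      constructor
      · rintro ⟨⟨h1, h2⟩, h3⟩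
        rw [abs_of_pos h3] at h2 hne
        exact ⟨h1, by omega⟩
      · rintro ⟨h1, h2⟩
        have h3 : 0 < vv σ o := lt_of_le_of_lt (abs_nonneg _) h2
        exact ⟨⟨h1, by rw [abs_of_pos h3]; omega⟩, h3⟩
    · intro σ hσ
      exact W_sw (by omega) ε σ (lt_of_le_of_lt (le_abs_self _) hσ.2)
  have e4 : S ε (fun σ => (P σ ∧ ¬ |vv σ z| < |vv σ o|) ∧ ¬ 0 < vv σ z) =
      1 * S ε (fun σ => (P σ ∧ ¬ |vv σ z| < |vv σ o|) ∧ 0 < vv σ z) := by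
    refine S_transport _ _ _ _ (ng z) (ng_invol z) _ ?_ ?_
    · intro σ
      rw [hP0, vv_ng_self, vv_ng_ne z σ hzo.symm, abs_neg]
      have := vv_ne_zero σ z
      constructor
      · rintro ⟨h1, h3⟩
        exact ⟨h1, by omega⟩
      · rintro ⟨h1, h3⟩
        exact ⟨h1, by omega⟩
    · intro σ _
      rw [one_mul]
      exact W_ng0 z hz ε σ
  rw [e4, e1, e2, e3]
  ring

theorem S_zero {n : ℕ} {i j : Fin n} (h : (j : ℕ) = i + 1) (ε : Fin n → Bool)
    (hε : ε i = ε j) : S ε (fun _ => True) = 0 := by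
  rw [S_asc h ε _ (fun _ => Iff.rfl)]
  have : ε ∘ Equiv.swap i j = ε := by
    funext p
    simp only [Function.comp_apply, Equiv.swap_apply_def]
    split_ifs with h1 h2
    · rw [h1, hε]
    · rw [h2, hε]
    · rfl
  rw [this]
  simp [yv, hε]

theorem W_double {n : ℕ} (ε : Fin n → Bool) (σ : SP n) :
    W ε σ = ∏ p, ∏ q, if p < q then yv (ε p) (ε q) ^ cc (vv σ p) (vv σ q) else 1 := by
  unfold W
  rw [Finset.prod_filter, Fintype.prod_prod_type]

/-- Insert the maximal value at position `p` into a permutation. -/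
def insPerm {n : ℕ} (p : Fin (n + 1)) (τ : Equiv.Perm (Fin n)) : Equiv.Perm (Fin (n + 1)) :=
  (finSuccEquiv' p).trans (τ.optionCongr.trans (finSuccEquiv' (Fin.last n)).symm)

theorem insPerm_self {n : ℕ} (p : Fin (n + 1)) (τ : Equiv.Perm (Fin n)) :
    insPerm p τ p = Fin.last n := by
  simp [insPerm]

theorem insPerm_succAbove {n : ℕ} (p : Fin (n + 1)) (τ : Equiv.Perm (Fin n)) (j : Fin n) :
    insPerm p τ (p.succAbove j) = (τ j).castSucc := by
  simp [insPerm]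

theorem insPerm_bij {n : ℕ} : Function.Bijective
    (fun x : Fin (n + 1) × Equiv.Perm (Fin n) => insPerm x.1 x.2) := by
  rw [Fintype.bijective_iff_injective_and_card]
  constructor
  · rintro ⟨p, τ⟩ ⟨p', τ'⟩ h
    simp only at h
    have hp : p = p' := by
      apply (insPerm p τ).injective
      rw [insPerm_self]
      rw [h, insPerm_self]
    subst hp
    congr 1
    ext j
    have := congrArg (fun e => e (p.succAbove j)) h
    simp only [insPerm_succAbove] at this
    have h2 := congrArg Fin.val this
    simpa using h2
  · simp [Fintype.card_perm, Nat.factorial_succ]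

/-- Insert the maximal absolute value at position `p` with sign `b`. -/
def ins {n : ℕ} (p : Fin (n + 1)) (b : Bool) (σ : SP n) : SP (n + 1) :=
  (insPerm p σ.1, Fin.insertNth (α := fun _ => Bool) p b σ.2)

theorem vv_ins_self {n : ℕ} (p : Fin (n + 1)) (b : Bool) (σ : SP n) :
    vv (ins p b σ) p = (if b then (-1 : ℤ) else 1) * (n + 1) := by
  simp [vv, ins, insPerm_self]

theorem vv_ins_succAbove {n : ℕ} (p : Fin (n + 1)) (b : Bool) (σ : SP n) (j : Fin n) :
    vv (ins p b σ) (p.succAbove j) = vv σ j := by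
  simp [vv, ins, insPerm_succAbove]

/-- Factor contributed by the maximal absolute value. -/
noncomputable def fac {n : ℕ} (ε : Fin (n + 1) → Bool) (p : Fin (n + 1)) (b : Bool) :
    Polynomial ℤ :=
  ∏ j : Fin n, if p < p.succAbove j then yv (ε p) (ε (p.succAbove j)) else
    if b then yv (ε p) (ε (p.succAbove j)) ^ 2 else 1

theorem W_ins {n : ℕ} (ε : Fin (n + 1) → Bool) (p : Fin (n + 1)) (b : Bool) (σ : SP n) :
    W ε (ins p b σ) = fac ε p b * W (ε ∘ p.succAbove) σ := by
  rw [W_double, W_double, Fin.prod_univ_succAbove _ p, Fin.prod_univ_succAbove _ p]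
  simp only [lt_self_iff_false, if_false, one_mul]
  have : ∀ i : Fin n, (∏ q, if p.succAbove i < q then
      yv (ε (p.succAbove i)) (ε q) ^ cc (vv (ins p b σ) (p.succAbove i)) (vv (ins p b σ) q)
      else 1) = (if p.succAbove i < p then
      yv (ε (p.succAbove i)) (ε p) ^ cc (vv σ i) (vv (ins p b σ) p) else 1) *
      ∏ j : Fin n, if i < j then yv ((ε ∘ p.succAbove) i) ((ε ∘ p.succAbove) j) ^
        cc (vv σ i) (vv σ j) else 1 := by
    intro i
    rw [Fin.prod_univ_succAbove _ p]
    simp only [vv_ins_succAbove, Function.comp_apply, Fin.succAbove_lt_succAbove_iff]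
  simp only [this, Finset.prod_mul_distrib]
  rw [← mul_assoc, ← Finset.prod_mul_distrib]
  congr 1
  unfold fac
  refine Finset.prod_congr rfl fun j _ => ?_
  rw [vv_ins_succAbove, vv_ins_self, yv_comm (ε (p.succAbove j))]
  have hb : |vv σ j| < n + 1 := by
    rw [vv_abs]; have := (σ.1 j).2; omega
  rw [abs_lt] at hb
  have hne : p.succAbove j ≠ p := Fin.succAbove_ne p j
  by_cases h : p < p.succAbove j
  · rw [if_pos h, if_neg (not_lt.2 h.le), if_pos h, mul_one]
    have : cc ((if b then (-1 : ℤ) else 1) * (n + 1)) (vv σ j) = 1 := by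
      unfold cc
      cases b <;> simp only [Bool.false_eq_true, if_false, if_true] <;> split_ifs <;> omega
    rw [this, pow_one]
  · have h' : p.succAbove j < p := lt_of_le_of_ne (not_lt.1 h) hne
    rw [if_neg h, if_pos h', if_neg h, one_mul]
    have : cc (vv σ j) ((if b then (-1 : ℤ) else 1) * (n + 1)) = if b then 2 else 0 := by
      unfold cc
      cases b <;> simp only [Bool.false_eq_true, if_false, if_true] <;> split_ifs <;> omega
    rw [this]
    cases b <;> simp

/-- The full sum of weights. -/
noncomputable def AA {n : ℕ} (ε : Fin n → Bool) : Polynomial ℤ := S ε (fun _ => True)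

theorem AA_eq {n : ℕ} (ε : Fin n → Bool) : AA ε = ∑ σ : SP n, W ε σ := by
  simp [AA, S]

theorem AA_rec {n : ℕ} (ε : Fin (n + 1) → Bool) :
    AA ε = ∑ p : Fin (n + 1), (fac ε p false + fac ε p true) * AA (ε ∘ p.succAbove) := by
  rw [AA_eq, Fintype.sum_prod_type, ← Equiv.sum_comp (Equiv.ofBijective _ insPerm_bij),
    Fintype.sum_prod_type]
  refine Finset.sum_congr rfl fun p _ => ?_
  rw [AA_eq, Fintype.sum_prod_type, Finset.mul_sum]
  refine Finset.sum_congr rfl fun τ _ => ?_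
  rw [← Equiv.sum_comp (Fin.insertNthEquiv (fun _ => Bool) p), Fintype.sum_prod_type,
    Finset.mul_sum]
  simp only [Fintype.sum_bool]
  rw [← Finset.sum_add_distrib]
  refine Finset.sum_congr rfl fun s _ => ?_
  have e : ∀ b : Bool, W ε ((Equiv.ofBijective _ insPerm_bij) (p, τ),
      (Fin.insertNthEquiv (fun _ => Bool) p) (b, s)) =
      fac ε p b * W (ε ∘ p.succAbove) (τ, s) := fun b => W_ins ε p b (τ, s)
  rw [e, e]
  ring

theorem prod_even (n : ℕ) : (∏ j ∈ Finset.range n, (if j % 2 = 0 then (-1 : Polynomial ℤ) else -X))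
    = (-1) ^ n * X ^ (n / 2) := by
  induction n with
  | zero => simp
  | succ n ih =>
    rw [Finset.prod_range_succ, ih]
    rcases Nat.even_or_odd' n with ⟨m, rfl | rfl⟩
    · rw [if_pos (by omega), show (2 * m + 1) / 2 = 2 * m / 2 by omega]; ring
    · rw [if_neg (by omega), show (2 * m + 1 + 1) / 2 = (2 * m + 1) / 2 + 1 by omega]; ring

theorem prod_odd (n : ℕ) : (∏ j ∈ Finset.range n, (if j % 2 = 1 then (-1 : Polynomial ℤ) else -X))
    = (-1) ^ n * X ^ ((n + 1) / 2) := by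
  induction n with
  | zero => simp
  | succ n ih =>
    rw [Finset.prod_range_succ, ih]
    rcases Nat.even_or_odd' n with ⟨m, rfl | rfl⟩
    · rw [if_neg (by omega), show (2 * m + 1 + 1) / 2 = (2 * m + 1) / 2 + 1 by omega]; ring
    · rw [if_pos (by omega), show (2 * m + 1 + 1 + 1) / 2 = (2 * m + 1 + 1) / 2 by omega]; ring

theorem fac_zero {n : ℕ} (ε : Fin (n + 1) → Bool) (hε : ∀ p q, ε p = ε q ↔ (p : ℕ) % 2 = q % 2)
    (b : Bool) : fac ε 0 b = (-1) ^ n * X ^ ((n + 1) / 2) := by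
  unfold fac
  rw [← prod_odd, ← Fin.prod_univ_eq_prod_range]
  refine Finset.prod_congr rfl fun j _ => ?_
  have h0 : (0 : Fin (n + 1)) < Fin.succAbove 0 j := by simp
  rw [if_pos h0]
  unfold yv
  have : (ε 0 = ε (Fin.succAbove 0 j)) ↔ (j : ℕ) % 2 = 1 := by
    rw [hε]; simp; omega
  simp only [this]

theorem fac_last {n : ℕ} (ε : Fin (n + 1) → Bool) (hε : ∀ p q, ε p = ε q ↔ (p : ℕ) % 2 = q % 2) :
    fac ε (Fin.last n) false + fac ε (Fin.last n) true = 1 + X ^ (2 * ((n + 1) / 2)) := by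
  have h0 : ∀ j : Fin n, ¬ Fin.last n < Fin.succAbove (Fin.last n) j :=
    fun j => not_lt.2 (Fin.le_last _)
  unfold fac
  simp only [h0, if_false, if_true, Bool.false_eq_true, Finset.prod_const_one]
  congr 1
  rw [Finset.prod_pow]
  have key : ∏ j : Fin n, yv (ε (Fin.last n)) (ε ((Fin.last n).succAbove j)) =
      (-1) ^ n * X ^ ((n + 1) / 2) := by
    have hc : ∀ j : Fin n, (ε (Fin.last n) = ε ((Fin.last n).succAbove j)) ↔
        n % 2 = (j : ℕ) % 2 := by
      intro j; rw [hε]; simp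
    unfold yv
    simp only [hc]
    rw [Fin.prod_univ_eq_prod_range (fun j => if n % 2 = j % 2 then (-1 : Polynomial ℤ) else -X)]
    rcases Nat.mod_two_eq_zero_or_one n with h | h
    · rw [show (n + 1) / 2 = n / 2 by omega, ← prod_even]
      simp only [h, eq_comm]
    · rw [← prod_odd]
      simp only [h, eq_comm]
  rw [key, mul_pow, ← pow_mul, ← pow_mul, mul_comm n 2, pow_mul (-1 : Polynomial ℤ)]
  simp [mul_comm]

theorem AA_closed (n : ℕ) (hn : 1 ≤ n) : ∀ (ε : Fin n → Bool),
    (∀ p q, ε p = ε q ↔ (p : ℕ) % 2 = q % 2) →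
    AA ε = 2 * ∏ j ∈ Finset.Icc 2 n, (1 + (-1 : Polynomial ℤ) ^ (j - 1) * X ^ (j / 2)) ^ 2 := by
  induction n, hn using Nat.le_induction with
  | base =>
    intro ε _
    rw [AA_eq]
    have : ∀ σ : SP 1, W ε σ = 1 := by
      intro σ
      rw [W_double]
      simp
    simp [this]
  | succ n hn ih =>
    intro ε hε
    have h0l : (0 : Fin (n + 1)) ≠ Fin.last n := by
      intro h; have := congrArg Fin.val h; simp at this; omega
    rw [AA_rec, Finset.sum_eq_add (0 : Fin (n + 1)) (Fin.last n) h0l]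
    · rw [fac_zero ε hε, fac_zero ε hε, fac_last ε hε, ih, ih,
        Finset.prod_Icc_succ_top (by omega)]
      · simp only [Nat.add_sub_cancel]
        have : ((-1 : Polynomial ℤ) ^ n) ^ 2 = 1 := by
          rw [← pow_mul, mul_comm, pow_mul]; simp
        rw [mul_comm 2 ((n + 1) / 2), pow_mul]
        linear_combination (-2 * (X ^ ((n + 1) / 2)) ^ 2 * ∏ j ∈ Finset.Icc 2 n,
          (1 + (-1 : Polynomial ℤ) ^ (j - 1) * X ^ (j / 2)) ^ 2) * this
      · intro p q
        simp only [Function.comp_apply]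
        rw [hε]; simp
      · intro p q
        simp only [Function.comp_apply]
        rw [hε]; simp; omega
    · rintro p - ⟨hp0, hpl⟩
      have hp1 : 0 < (p : ℕ) := by
        rcases Nat.eq_zero_or_pos (p : ℕ) with h | h
        · exact absurd (Fin.ext h) hp0
        · exact h
      have hp2 : (p : ℕ) < n := by
        have h3 := p.2
        have : (p : ℕ) ≠ n := fun h => hpl (Fin.ext h)
        omega
      have : AA (ε ∘ p.succAbove) = 0 := by
        refine S_zero (i := ⟨p - 1, by omega⟩) (j := ⟨p, hp2⟩) ?_ _ ?_
        · simp; omega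
        · simp only [Function.comp_apply]
          rw [hε, Fin.succAbove_of_castSucc_lt, Fin.succAbove_of_le_castSucc]
          · simp; omega
          · rw [Fin.le_def]; simp
          · show (p : ℕ) - 1 < p
            omega
      rw [this, mul_zero]
    · simp
    · simp

/-- Parity letters. -/
def par {n : ℕ} (p : Fin n) : Bool := decide ((p : ℕ) % 2 = 1)

theorem par_eq {n : ℕ} (p q : Fin n) : par p = par q ↔ (p : ℕ) % 2 = q % 2 := by
  unfold par
  rw [decide_eq_decide]
  omega

theorem sval_succ {n : ℕ} (σ : SP n) (p : Fin n) : sval σ ((p : ℕ) + 1) = vv σ p := by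
  unfold sval vv
  rw [dif_pos ⟨by omega, by have := p.2; omega⟩]
  rfl

theorem card_pairs (n : ℕ) (P : ℕ × ℕ → Prop) [DecidablePred P] :
    ((pairs n).filter P).card =
      ∑ r ∈ (Finset.univ : Finset (Fin n × Fin n)).filter (fun r => r.1 < r.2),
        if P ((r.1 : ℕ) + 1, (r.2 : ℕ) + 1) then 1 else 0 := by
  rw [Finset.card_filter]
  symm
  refine Finset.sum_bij (fun r _ => ((r.1 : ℕ) + 1, (r.2 : ℕ) + 1)) ?_ ?_ ?_ ?_
  · rintro ⟨p, q⟩ hr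
    have h1 := p.2
    have h2 := q.2
    simp only [Finset.mem_filter, Finset.mem_univ, true_and, Fin.lt_def] at hr
    simp only [pairs, Finset.mem_filter, Finset.mem_product, Finset.mem_Icc]
    omega
  · rintro ⟨p, q⟩ _ ⟨p', q'⟩ _ h
    simp only [Prod.mk.injEq] at h
    rw [Prod.mk.injEq]
    exact ⟨Fin.ext (by omega), Fin.ext (by omega)⟩
  · rintro ⟨a, b⟩ h
    simp only [pairs, Finset.mem_filter, Finset.mem_product, Finset.mem_Icc] at h
    refine ⟨(⟨a - 1, by omega⟩, ⟨b - 1, by omega⟩), ?_, ?_⟩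
    · simp only [Finset.mem_filter, Finset.mem_univ, true_and, Fin.lt_def]
      omega
    · simp only [Prod.mk.injEq]
      omega
  · intro r _
    rfl

theorem weight_eq {n : ℕ} (σ : SP n) :
    (-1 : Polynomial ℤ) ^ ellD σ * X ^ LD σ = W par σ := by
  unfold ellD LD invSP nspSP oinvSP onspSP
  rw [card_pairs, card_pairs, card_pairs, card_pairs]
  simp only [sval_succ]
  rw [← Finset.sum_add_distrib, ← Finset.sum_add_distrib, ← Finset.prod_pow_eq_pow_sum,
    ← Finset.prod_pow_eq_pow_sum, ← Finset.prod_mul_distrib]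
  unfold W
  refine Finset.prod_congr rfl fun r _ => ?_
  unfold yv cc
  simp only [par_eq]
  by_cases h : (r.1 : ℕ) % 2 = (r.2 : ℕ) % 2
  · have h' : ((r.1 : ℕ) + 1) % 2 = ((r.2 : ℕ) + 1) % 2 := by omega
    simp [h, h']
  · have h' : ((r.1 : ℕ) + 1) % 2 ≠ ((r.2 : ℕ) + 1) % 2 := by omega
    rw [if_neg h]
    simp only [h', ne_eq, not_false_eq_true, and_true]
    rw [← mul_pow]
    simp

/-- Negate the entry of absolute value one. -/
def fl {n : ℕ} (z : Fin n) (σ : SP n) : SP n := ng (σ.1.symm z) σ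

theorem fl_invol {n : ℕ} (z : Fin n) : Function.Involutive (fl z) := by
  intro σ
  exact ng_invol (σ.1.symm z) σ

theorem vv_fl {n : ℕ} (z : Fin n) (hz : (z : ℕ) = 0) (σ : SP n) (p : Fin n) :
    vv (fl z σ) p = vv σ p ∨ (|vv σ p| = 1 ∧ vv (fl z σ) p = - vv σ p) := by
  unfold fl
  by_cases h : p = σ.1.symm z
  · right
    subst h
    refine ⟨?_, vv_ng_self _ _⟩
    rw [vv_abs]; simp [hz]
  · left
    exact vv_ng_ne _ _ h

theorem abs_vv_pos {n : ℕ} (σ : SP n) (p : Fin n) : 1 ≤ |vv σ p| := by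
  rw [vv_abs]; omega

theorem fl_lt {n : ℕ} (z : Fin n) (hz : (z : ℕ) = 0) (σ : SP n) {p q : Fin n} (h : p ≠ q) :
    vv (fl z σ) p < vv (fl z σ) q ↔ vv σ p < vv σ q := by
  have h1 := vv_abs_ne σ h
  have h2 := abs_vv_pos σ p
  have h3 := abs_vv_pos σ q
  have h4 := vv_fl z hz σ p
  have h5 := vv_fl z hz σ q
  rcases abs_cases (vv σ p) with ⟨h6, h7⟩ | ⟨h6, h7⟩ <;>
  rcases abs_cases (vv σ q) with ⟨h8, h9⟩ | ⟨h8, h9⟩ <;> rw [h6, h8] at h1 <;>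
  rw [h6] at h2 h4 <;> rw [h8] at h3 h5 <;> omega

theorem fl_sum {n : ℕ} (z : Fin n) (hz : (z : ℕ) = 0) (σ : SP n) {p q : Fin n} (h : p ≠ q) :
    vv (fl z σ) p + vv (fl z σ) q < 0 ↔ vv σ p + vv σ q < 0 := by
  have h1 := vv_abs_ne σ h
  have h2 := abs_vv_pos σ p
  have h3 := abs_vv_pos σ q
  have h4 := vv_fl z hz σ p
  have h5 := vv_fl z hz σ q
  rcases abs_cases (vv σ p) with ⟨h6, h7⟩ | ⟨h6, h7⟩ <;>
  rcases abs_cases (vv σ q) with ⟨h8, h9⟩ | ⟨h8, h9⟩ <;> rw [h6, h8] at h1 <;>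
  rw [h6] at h2 h4 <;> rw [h8] at h3 h5 <;> omega

theorem W_fl {n : ℕ} (z : Fin n) (hz : (z : ℕ) = 0) (ε : Fin n → Bool) (σ : SP n) :
    W ε (fl z σ) = W ε σ := by
  unfold W
  refine Finset.prod_congr rfl ?_
  rintro ⟨p, q⟩ hr
  simp only [Finset.mem_filter, Finset.mem_univ, true_and] at hr ⊢
  unfold cc
  simp only [fl_lt z hz σ hr.ne', fl_sum z hz σ hr.ne]

theorem even_ng {n : ℕ} (j : Fin n) (σ : SP n) : IsEvenSP (ng j σ) ↔ ¬ IsEvenSP σ := by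
  unfold IsEvenSP
  have e : ∀ τ : SP n, (Finset.univ.filter (fun i => τ.2 i = true)).card =
      (if τ.2 j = true then 1 else 0) +
        ∑ i ∈ Finset.univ.erase j, if τ.2 i = true then 1 else 0 := by
    intro τ
    rw [Finset.card_filter, ← Finset.add_sum_erase _ _ (Finset.mem_univ j)]
  rw [e, e]
  have : (∑ i ∈ Finset.univ.erase j, if (ng j σ).2 i = true then 1 else 0) =
      ∑ i ∈ Finset.univ.erase j, if σ.2 i = true then 1 else 0 := by
    refine Finset.sum_congr rfl fun i hi => ?_
    have := Finset.ne_of_mem_erase hi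
    simp [ng, this]
  rw [this]
  have h2 : (ng j σ).2 j = ! σ.2 j := by simp [ng]
  rw [h2, Nat.even_iff, Nat.even_iff]
  cases σ.2 j <;> simp <;> omega

theorem inQuot_iff {n : ℕ} (i : ℕ) (hi : 3 ≤ i) (z o i0 i1 : Fin n) (hz : (z : ℕ) = 0)
    (ho : (o : ℕ) = 1) (h0 : (i0 : ℕ) + 1 = i) (h1 : (i1 : ℕ) = i) (σ : SP n) :
    InQuot σ {0, 1, i} ↔ (vv σ i0 < vv σ i1 ∧ |vv σ z| < vv σ o) := by
  have e1 : sval σ 1 = vv σ z := by rw [← sval_succ, hz]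
  have e2 : sval σ 2 = vv σ o := by rw [← sval_succ, ho]
  have e3 : sval σ i = vv σ i0 := by rw [← sval_succ, h0]
  have e4 : sval σ (i + 1) = vv σ i1 := by rw [← sval_succ, h1]
  unfold InQuot
  simp only [Finset.mem_insert, Finset.mem_singleton, forall_eq_or_imp, forall_eq, dval]
  rw [if_neg (show ¬ i = 0 by omega), if_neg (show ¬ i + 1 = 0 by omega), e3, e4]
  simp only [if_true, zero_add, one_ne_zero, if_false, Nat.reduceAdd, OfNat.ofNat_ne_zero, e1, e2]
  rw [abs_lt]
  tauto

theorem two_genD {n : ℕ} (i : ℕ) (hi : 3 ≤ i) (z o i0 i1 : Fin n) (hz : (z : ℕ) = 0)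
    (ho : (o : ℕ) = 1) (h0 : (i0 : ℕ) + 1 = i) (h1 : (i1 : ℕ) = i) :
    2 * genD n {0, 1, i} = S par (fun σ => vv σ i0 < vv σ i1 ∧ |vv σ z| < vv σ o) := by
  have hg : genD n {0, 1, i} =
      S par (fun σ => (vv σ i0 < vv σ i1 ∧ |vv σ z| < vv σ o) ∧ IsEvenSP σ) := by
    unfold genD S
    rw [Finset.sum_filter]
    refine Finset.sum_congr rfl fun σ _ => ?_
    rw [weight_eq]
    have := inQuot_iff i hi z o i0 i1 hz ho h0 h1 σ
    by_cases hE : IsEvenSP σ <;> by_cases hQ : InQuot σ {0, 1, i} <;> simp [hE, hQ, ← this]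
  rw [S_split par _ IsEvenSP, ← hg, two_mul]
  congr 1
  rw [hg, ← one_mul (S _ _)]
  symm
  refine S_transport _ _ _ _ (fl z) (fl_invol z) _ ?_ ?_
  · intro σ
    have h01 : i0 ≠ i1 := by intro e; rw [e] at h0; omega
    have hzo : z ≠ o := by intro e; rw [e] at hz; omega
    rw [fl_lt z hz σ h01, show IsEvenSP (fl z σ) ↔ ¬ IsEvenSP σ from even_ng _ _, not_not]
    rw [abs_lt, abs_lt]
    have a1 := fl_lt z hz σ hzo
    have a2 := fl_sum z hz σ hzo
    have a3 : - vv (fl z σ) o < vv (fl z σ) z ↔ - vv σ o < vv σ z := by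
      have b1 := vv_ne_zero σ z
      have b2 := vv_abs_ne σ hzo
      have h1 := vv_abs_ne σ hzo
      have h2 := abs_vv_pos σ z
      have h3 := abs_vv_pos σ o
      have h4 := vv_fl z hz σ z
      have h5 := vv_fl z hz σ o
      rcases abs_cases (vv σ z) with ⟨h6, h7⟩ | ⟨h6, h7⟩ <;>
      rcases abs_cases (vv σ o) with ⟨h8, h9⟩ | ⟨h8, h9⟩ <;> rw [h6, h8] at h1 <;>
      rw [h6] at h2 h4 <;> rw [h8] at h3 h5 <;> omega
    rw [a1, a3]
  · intro σ _
    rw [one_mul]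
    exact W_fl z hz _ σ

theorem main_eq {n : ℕ} (hn : 5 ≤ n) (i : ℕ) (hi : 3 ≤ i) (z o i0 i1 : Fin n) (hz : (z : ℕ) = 0)
    (ho : (o : ℕ) = 1) (h0 : (i0 : ℕ) + 1 = i) (h1 : (i1 : ℕ) = i) :
    (1 - X ^ 2) ^ 3 * S par (fun σ => vv σ i0 < vv σ i1 ∧ |vv σ z| < vv σ o) =
      (1 + X ^ 2) * AA (par : Fin n → Bool) := by
  have hzi0 : i0 ≠ z := by intro e; rw [e] at h0; omega
  have hzi1 : i1 ≠ z := by intro e; rw [e] at h1; omega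
  have hoi0 : i0 ≠ o := by intro e; rw [e] at h0; omega
  have hoi1 : i1 ≠ o := by intro e; rw [e] at h1; omega
  have hij : (i1 : ℕ) = i0 + 1 := by omega
  have hzo1 : (o : ℕ) = z + 1 := by omega
  -- the letters after the swaps
  have f1 : ∀ p : Fin n, p ≠ z → p ≠ o → Equiv.swap z o p = p :=
    fun p h h' => Equiv.swap_apply_of_ne_of_ne h h'
  have f2 : ∀ p : Fin n, p ≠ i0 → p ≠ i1 → Equiv.swap i0 i1 p = p :=
    fun p h h' => Equiv.swap_apply_of_ne_of_ne h h'
  have inv2 : ∀ e : Fin n → Bool, (e ∘ Equiv.swap i0 i1) ∘ Equiv.swap i0 i1 = e := by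
    intro e; funext p; simp
  have inv1 : ∀ e : Fin n → Bool, (e ∘ Equiv.swap z o) ∘ Equiv.swap z o = e := by
    intro e; funext p; simp
  have py : ∀ p q : Fin n, (q : ℕ) = p + 1 → yv (par p) (par q) = -X := by
    intro p q h
    unfold yv
    rw [if_neg]
    rw [par_eq]; omega
  have py' : ∀ p q : Fin n, (q : ℕ) = p + 1 → yv (par q) (par p) = -X := by
    intro p q h
    rw [yv_comm, py p q h]
  -- vanishing of the three other full sums
  have A10 : AA ((par : Fin n → Bool) ∘ Equiv.swap z o) = 0 := by
    refine S_zero (i := o) (j := ⟨2, by omega⟩) (by simp; omega) _ ?_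
    simp only [Function.comp_apply, Equiv.swap_apply_right]
    rw [f1, par_eq]
    · simp; omega
    · intro e; rw [← e] at hz; simp at hz
    · intro e; rw [← e] at ho; simp at ho
  have A01 : AA ((par : Fin n → Bool) ∘ Equiv.swap i0 i1) = 0 := by
    refine S_zero (i := ⟨i - 2, by omega⟩) (j := i0) (by simp; omega) _ ?_
    simp only [Function.comp_apply, Equiv.swap_apply_left]
    rw [f2, par_eq]
    · simp; omega
    · intro e; rw [← e] at h0; simp at h0; omega
    · intro e; rw [← e] at h1; simp at h1; omega
  have A11 : AA (((par : Fin n → Bool) ∘ Equiv.swap z o) ∘ Equiv.swap i0 i1) = 0 := by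
    rcases Nat.lt_or_ge 3 i with h3 | h3
    · refine S_zero (i := ⟨i - 2, by omega⟩) (j := i0) (by simp; omega) _ ?_
      simp only [Function.comp_apply, Equiv.swap_apply_left]
      rw [f2, f1 i1 hzi1 hoi1, f1, par_eq]
      · simp; omega
      · intro e; rw [← e] at hz; simp at hz; omega
      · intro e; rw [← e] at ho; simp at ho; omega
      · intro e; rw [← e] at h0; simp at h0; omega
      · intro e; rw [← e] at h1; simp at h1; omega
    · refine S_zero (i := i1) (j := ⟨4, by omega⟩) (by simp; omega) _ ?_
      simp only [Function.comp_apply, Equiv.swap_apply_right]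
      rw [f2, f1 i0 hzi0 hoi0, f1, par_eq]
      · simp; omega
      · intro e; rw [← e] at hz; simp at hz
      · intro e; rw [← e] at ho; simp at ho
      · intro e; rw [← e] at h0; simp at h0; omega
      · intro e; rw [← e] at h1; simp at h1; omega
  -- first family of equations
  have E : ∀ e : Fin n → Bool, AA e = S e (fun σ => vv σ i0 < vv σ i1) +
      yv (e i0) (e i1) * S (e ∘ Equiv.swap i0 i1) (fun σ => vv σ i0 < vv σ i1) := by
    intro e
    have := S_asc hij e (fun _ => True) (fun _ => Iff.rfl)
    simp only [true_and] at this
    exact this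
  have E00 := E par
  have E01 := E (par ∘ Equiv.swap i0 i1)
  have E10 := E (par ∘ Equiv.swap z o)
  have E11 := E ((par ∘ Equiv.swap z o) ∘ Equiv.swap i0 i1)
  rw [inv2] at E01 E11
  simp only [Function.comp_apply, Equiv.swap_apply_left, Equiv.swap_apply_right] at E01 E11 E10
  rw [f1 i0 hzi0 hoi0, f1 i1 hzi1 hoi1] at E10 E11
  rw [py i0 i1 hij] at E00 E10
  rw [py' i0 i1 hij] at E01 E11
  rw [A01] at E01
  rw [A10] at E10
  rw [A11] at E11
  -- second family of equations
  have F : ∀ e : Fin n → Bool, S e (fun σ => vv σ i0 < vv σ i1) =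
      (1 + yv (e z) (e o) ^ 2) * S e (fun σ => vv σ i0 < vv σ i1 ∧ |vv σ z| < vv σ o) +
      2 * yv (e z) (e o) * S (e ∘ Equiv.swap z o)
        (fun σ => vv σ i0 < vv σ i1 ∧ |vv σ z| < vv σ o) := by
    intro e
    refine S_quot hz ho e (fun σ => vv σ i0 < vv σ i1) ?_ ?_ ?_
    · intro σ
      rw [vv_sw, vv_sw, f1 i0 hzi0 hoi0, f1 i1 hzi1 hoi1]
    · intro σ
      rw [vv_ng_ne z σ hzi0, vv_ng_ne z σ hzi1]
    · intro σ
      rw [vv_ng_ne o σ hoi0, vv_ng_ne o σ hoi1]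
  have F0 := F par
  have F1 := F (par ∘ Equiv.swap z o)
  rw [inv1] at F1
  simp only [Function.comp_apply, Equiv.swap_apply_left, Equiv.swap_apply_right] at F1
  rw [py z o hzo1] at F0
  rw [py' z o hzo1] at F1
  have hne : (1 - X ^ 2 : Polynomial ℤ) ≠ 0 := by
    intro h
    have := congrArg (Polynomial.eval 0) h
    simp at this
  have B10 : S (par ∘ Equiv.swap z o) (fun σ => vv σ i0 < vv σ i1) = 0 := by
    apply mul_left_cancel₀ hne
    linear_combination -E10 - X * E11
  rw [B10] at F1
  have B00 : (1 - X ^ 2) * S par (fun σ => vv σ i0 < vv σ i1) = AA (par : Fin n → Bool) := by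
    linear_combination -E00 - X * E01
  rw [← B00]
  linear_combination (-(1 - X ^ 2) * (1 + X ^ 2)) * F0 - 2 * X * (1 - X ^ 2) * F1

/-- Conjecture 1.3 (second part), proved in the paper: for `n ≥ 5` and `3 ≤ i ≤ n-1`,
`D_n^{{0,1,i}}(x) = (1 - x⁴) ∏_{j=5}^{n} (1 + (-1)^{j-1} x^{⌊j/2⌋})²`. -/
theorem stmt14 (n i : ℕ) (hn : 5 ≤ n) (hi : 3 ≤ i) (hi' : i ≤ n - 1) :
    genD n {0, 1, i} =
      (1 - X ^ 4) *
        ∏ j ∈ Finset.Icc 5 n, (1 + (-1 : Polynomial ℤ) ^ (j - 1) * X ^ (j / 2)) ^ 2 := by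
  have hz : 0 < n := by omega
  have ho : 1 < n := by omega
  have hi0 : i - 1 < n := by omega
  have hi1 : i < n := by omega
  have h1 := two_genD (n := n) i hi ⟨0, hz⟩ ⟨1, ho⟩ ⟨i - 1, hi0⟩ ⟨i, hi1⟩ rfl rfl
    (by simp; omega) rfl
  have h2 := main_eq (n := n) hn i hi ⟨0, hz⟩ ⟨1, ho⟩ ⟨i - 1, hi0⟩ ⟨i, hi1⟩ rfl rfl
    (by simp; omega) rfl
  rw [← h1, AA_closed n (by omega) par par_eq] at h2
  have h3 : ∏ j ∈ Finset.Icc 2 n, (1 + (-1 : Polynomial ℤ) ^ (j - 1) * X ^ (j / 2)) ^ 2 =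
      (1 - X ^ 2) ^ 4 *
        ∏ j ∈ Finset.Icc 5 n, (1 + (-1 : Polynomial ℤ) ^ (j - 1) * X ^ (j / 2)) ^ 2 := by
    have hI : ∀ a, a ≤ n → Finset.Icc a n = insert a (Finset.Icc (a + 1) n) := by
      intro a ha
      ext x
      simp only [Finset.mem_insert, Finset.mem_Icc]
      omega
    rw [hI 2 (by omega), Finset.prod_insert (by simp), hI 3 (by omega),
      Finset.prod_insert (by simp), hI 4 (by omega), Finset.prod_insert (by simp)]
    norm_num
    ring
  rw [h3] at h2
  have hne : (2 * (1 - X ^ 2) ^ 3 : Polynomial ℤ) ≠ 0 := by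
    intro h
    have := congrArg (Polynomial.eval 0) h
    simp at this
  apply mul_left_cancel₀ hne
  linear_combination h2

end OddLength
end

section
/- Let I ⊆ {0,1,…,n-1} with connected component containing 0 equal to [0,a_0-1], where a_0 ∈ [2,n-1] is even and a_0+1 ∉ I. Then Σ_{σ ∈ D_n^I} (-1)^{ℓ(σ)} x^{L(σ)} = (1 + x^{a_0}) Σ_{σ ∈ D_n^{I ∪ {a_0}}} (-1)^{ℓ(σ)} x^{L(σ)}. -/
open Polynomial Finset

namespace OddLength

/-- contribution of a pair of values to the length -/
def fpair (x y : ℤ) : ℕ := (if y < x then 1 else 0) + (if x + y < 0 then 1 else 0)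

/-- weighted length of a value sequence -/
def wsum (n : ℕ) (w : ℕ → ℕ → ℕ) (s : ℕ → ℤ) : ℕ :=
  ∑ j ∈ Finset.Icc 1 n, ∑ i ∈ Finset.Icc 1 n, if i < j then w i j * fpair (s i) (s j) else 0

/-- odd weight -/
def ow (i j : ℕ) : ℕ := if i % 2 ≠ j % 2 then 1 else 0

lemma ellD_eq {n : ℕ} (σ : SP n) : ellD σ = wsum n (fun _ _ => 1) (sval σ) := by
  unfold ellD invSP nspSP wsum pairs
  rw [Finset.card_filter, Finset.card_filter, ← Finset.sum_add_distrib, Finset.sum_filter,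
    Finset.sum_product, Finset.sum_comm]
  simp only [one_mul, fpair]

lemma LD_eq {n : ℕ} (σ : SP n) : LD σ = wsum n ow (sval σ) := by
  unfold LD oinvSP onspSP wsum pairs
  rw [Finset.card_filter, Finset.card_filter, ← Finset.sum_add_distrib, Finset.sum_filter,
    Finset.sum_product, Finset.sum_comm]
  refine Finset.sum_congr rfl fun j _ => Finset.sum_congr rfl fun i _ => ?_
  unfold fpair ow
  by_cases h : i % 2 = j % 2 <;> simp [h]

lemma fpair_zero {x y : ℤ} (h : |x| < y) : fpair x y = 0 := by
  rw [abs_lt] at h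
  unfold fpair
  rw [if_neg (by omega), if_neg (by omega)]

lemma fpair_two {x y : ℤ} (h : |x| < -y) : fpair x y = 2 := by
  rw [abs_lt] at h
  unfold fpair
  rw [if_pos (by omega), if_pos (by omega)]

lemma fpair_one {x y : ℤ} (h : |y| < |x|) : fpair x y = 1 := by
  unfold fpair
  rcases abs_cases x with ⟨h1, h2⟩ | ⟨h1, h2⟩ <;> rcases abs_cases y with ⟨h3, h4⟩ | ⟨h3, h4⟩ <;>
    split_ifs <;> omega

lemma fpair_congr {x x' y : ℤ} (h : |x| = |x'|) : fpair x y = fpair x' y := by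
  rcases abs_eq_abs.1 h with rfl | rfl
  · rfl
  · unfold fpair
    split_ifs <;> omega

/-- chain condition on the first `m` values -/
def Chain (m : ℕ) (s : ℕ → ℤ) : Prop := ∀ j, j ≤ m → ∀ i, 1 ≤ i → i < j → |s i| < s j

lemma wsum_swap {n m p : ℕ} {w : ℕ → ℕ → ℕ} {s s' : ℕ → ℤ} (hm : m + 1 ≤ n)
    (hp : 1 ≤ p) (hpm : p < m)
    (hw : ∀ j, w p j = w (m + 1) j)
    (hs : Chain m s) (hs' : Chain m s')
    (habs : ∀ i, 1 ≤ i → i ≤ n → |s' i| = |s (Equiv.swap p (m + 1) i)|)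
    (hj : ∀ i, m + 1 < i → s' i = s i)
    (hq : ∀ i, 1 ≤ i → i ≤ m → i ≠ p → fpair (s' i) (s' (m + 1)) = fpair (s i) (s (m + 1))) :
    wsum n w s + w p (m + 1) * fpair (s' p) (s' (m + 1))
      = wsum n w s' + w p (m + 1) * fpair (s p) (s (m + 1)) := by
  unfold wsum
  have hmem : m + 1 ∈ Finset.Icc 1 n := by simp; omega
  have hpmem : p ∈ Finset.Icc 1 n := by simp; omega
  rw [← Finset.add_sum_erase _ _ hmem, ← Finset.add_sum_erase (a := m + 1) (s := Finset.Icc 1 n)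
    (f := fun j => ∑ i ∈ Finset.Icc 1 n, if i < j then w i j * fpair (s' i) (s' j) else 0) hmem]
  have e1 : ∑ j ∈ (Finset.Icc 1 n).erase (m + 1), ∑ i ∈ Finset.Icc 1 n,
        (if i < j then w i j * fpair (s i) (s j) else 0)
      = ∑ j ∈ (Finset.Icc 1 n).erase (m + 1), ∑ i ∈ Finset.Icc 1 n,
        (if i < j then w i j * fpair (s' i) (s' j) else 0) := by
    refine Finset.sum_congr rfl fun j hjm => ?_
    simp only [Finset.mem_erase, Finset.mem_Icc] at hjm
    obtain ⟨hj1, hj2, hj3⟩ := hjm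
    rcases lt_or_gt_of_ne hj1 with hlt | hgt
    · refine Finset.sum_congr rfl fun i hi => ?_
      simp only [Finset.mem_Icc] at hi
      split_ifs with h
      · rw [fpair_zero (hs j (by omega) i hi.1 h), fpair_zero (hs' j (by omega) i hi.1 h)]
      · rfl
    · symm
      refine Finset.sum_equiv (Equiv.swap p (m + 1)) ?_ ?_
      · intro i
        simp only [Finset.mem_Icc, Equiv.swap_apply_def]
        split_ifs <;> omega
      · intro i hi
        simp only [Finset.mem_Icc] at hi
        rw [fpair_congr (habs i hi.1 hi.2), hj j hgt]
        have hlt : (Equiv.swap p (m + 1) i < j) ↔ i < j := by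
          simp only [Equiv.swap_apply_def]
          split_ifs <;> omega
        have hww : w (Equiv.swap p (m + 1) i) j = w i j := by
          simp only [Equiv.swap_apply_def]
          split_ifs with h1 h2
          · rw [h1, hw]
          · rw [h2, hw]
          · rfl
        simp only [hlt, hww]
  rw [e1]
  rw [← Finset.add_sum_erase _ _ hpmem, ← Finset.add_sum_erase (a := p) (s := Finset.Icc 1 n)
    (f := fun i => if i < m + 1 then w i (m + 1) * fpair (s' i) (s' (m + 1)) else 0) hpmem]
  have e2 : ∑ i ∈ (Finset.Icc 1 n).erase p,
        (if i < m + 1 then w i (m + 1) * fpair (s i) (s (m + 1)) else 0)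
      = ∑ i ∈ (Finset.Icc 1 n).erase p,
        (if i < m + 1 then w i (m + 1) * fpair (s' i) (s' (m + 1)) else 0) := by
    refine Finset.sum_congr rfl fun i hi => ?_
    simp only [Finset.mem_erase, Finset.mem_Icc] at hi
    split_ifs with h
    · rw [hq i hi.2.1 (by omega) hi.1]
    · rfl
  rw [e2]
  simp only [show p < m + 1 by omega, if_true]
  ring

lemma wsum_flip {n m : ℕ} {w : ℕ → ℕ → ℕ} {s s' : ℕ → ℤ} (hm : m + 1 ≤ n)
    (hs : Chain m s) (hs' : Chain m s')
    (hab : ∀ i, 1 ≤ i → i ≤ n → |s' i| = |s i|)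
    (hj : ∀ i, m + 1 < i → s' i = s i)
    (hq : ∀ i, 1 ≤ i → i ≤ m → |s i| < s (m + 1))
    (hq' : s' (m + 1) = - s (m + 1)) :
    wsum n w s' = wsum n w s + 2 * ∑ i ∈ Finset.Icc 1 m, w i (m + 1) := by
  unfold wsum
  have hmem : m + 1 ∈ Finset.Icc 1 n := by simp; omega
  rw [← Finset.add_sum_erase _ _ hmem, ← Finset.add_sum_erase (a := m + 1) (s := Finset.Icc 1 n)
    (f := fun j => ∑ i ∈ Finset.Icc 1 n, if i < j then w i j * fpair (s i) (s j) else 0) hmem]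
  have e1 : ∑ j ∈ (Finset.Icc 1 n).erase (m + 1), ∑ i ∈ Finset.Icc 1 n,
        (if i < j then w i j * fpair (s' i) (s' j) else 0)
      = ∑ j ∈ (Finset.Icc 1 n).erase (m + 1), ∑ i ∈ Finset.Icc 1 n,
        (if i < j then w i j * fpair (s i) (s j) else 0) := by
    refine Finset.sum_congr rfl fun j hjm => Finset.sum_congr rfl fun i hi => ?_
    simp only [Finset.mem_erase, Finset.mem_Icc] at hjm hi
    obtain ⟨hj1, hj2, hj3⟩ := hjm
    split_ifs with h
    · rcases lt_or_gt_of_ne hj1 with hlt | hgt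
      · rw [fpair_zero (hs j (by omega) i hi.1 h), fpair_zero (hs' j (by omega) i hi.1 h)]
      · rw [fpair_congr (hab i hi.1 hi.2), hj j hgt]
    · rfl
  rw [e1]
  have hf : (Finset.Icc 1 n).filter (fun i => i < m + 1) = Finset.Icc 1 m := by
    ext i; simp only [Finset.mem_filter, Finset.mem_Icc]; omega
  have e2 : ∑ i ∈ Finset.Icc 1 n, (if i < m + 1 then w i (m + 1) * fpair (s' i) (s' (m + 1)) else 0)
      = 2 * ∑ i ∈ Finset.Icc 1 m, w i (m + 1) := by
    rw [← Finset.sum_filter, hf, Finset.mul_sum]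
    refine Finset.sum_congr rfl fun i hi => ?_
    simp only [Finset.mem_Icc] at hi
    rw [fpair_two, mul_comm]
    rw [hab i hi.1 (by omega), hq', neg_neg]
    exact hq i hi.1 hi.2
  have e3 : ∑ i ∈ Finset.Icc 1 n, (if i < m + 1 then w i (m + 1) * fpair (s i) (s (m + 1)) else 0)
      = 0 := by
    refine Finset.sum_eq_zero fun i hi => ?_
    simp only [Finset.mem_Icc] at hi
    split_ifs with h
    · rw [fpair_zero (hq i hi.1 (by omega)), mul_zero]
    · rfl
  rw [e2, e3]
  ring

lemma ow_sum {m : ℕ} (hm : Even m) : 2 * ∑ i ∈ Finset.Icc 1 m, ow i (m + 1) = m := by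
  have key : ∀ k : ℕ, ∑ i ∈ Finset.Icc 1 (k + k), (if i % 2 ≠ 1 then 1 else 0) = k := by
    intro k
    induction k with
    | zero => simp
    | succ k ih =>
      rw [show k + 1 + (k + 1) = (k + k + 1) + 1 by ring, Finset.sum_Icc_succ_top (by omega),
        Finset.sum_Icc_succ_top (by omega), ih, if_neg (by omega), if_pos (by omega)]
  obtain ⟨k, rfl⟩ := hm
  have : ∀ i, ow i (k + k + 1) = if i % 2 ≠ 1 then 1 else 0 := by
    intro i; unfold ow; rw [show (k + k + 1) % 2 = 1 by omega]
  simp only [this, key]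
  ring

lemma abs_sval {n : ℕ} (σ : SP n) {i : ℕ} (h : 1 ≤ i ∧ i ≤ n) :
    |sval σ i| = ((σ.1 ⟨i - 1, by omega⟩ : Fin n) : ℕ) + 1 := by
  unfold sval
  rw [dif_pos h, abs_mul]
  have h1 : |(if σ.2 ⟨i - 1, by omega⟩ then (-1 : ℤ) else 1)| = 1 := by split_ifs <;> simp
  rw [h1, one_mul, abs_of_nonneg (by positivity)]

lemma sval_pos {n : ℕ} (σ : SP n) {i : ℕ} (h : 1 ≤ i ∧ i ≤ n) :
    0 < sval σ i ↔ σ.2 ⟨i - 1, by omega⟩ = false := by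
  unfold sval
  rw [dif_pos h]
  split_ifs with h1
  · simp only [h1]; simp; try omega
  · simp only [Bool.not_eq_true] at h1; simp only [h1]; simp; try omega

lemma abs_sval_ne {n : ℕ} (σ : SP n) {i j : ℕ} (hi : 1 ≤ i ∧ i ≤ n) (hj : 1 ≤ j ∧ j ≤ n)
    (hij : i ≠ j) : |sval σ i| ≠ |sval σ j| := by
  rw [abs_sval σ hi, abs_sval σ hj]
  intro h
  have h2 : (σ.1 ⟨i - 1, by omega⟩) = (σ.1 ⟨j - 1, by omega⟩) := by
    apply Fin.ext; exact_mod_cast (add_right_cancel h)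
  have h3 := σ.1.injective h2
  rw [Fin.mk.injEq] at h3
  omega

lemma sval_ne_zero {n : ℕ} (σ : SP n) {i : ℕ} (h : 1 ≤ i ∧ i ≤ n) : sval σ i ≠ 0 := by
  rw [← abs_pos, abs_sval σ h]; positivity

/-- swap absolute values at two positions (1-based) -/
def swp {n : ℕ} (σ : SP n) (p q : ℕ) (hp : 1 ≤ p ∧ p ≤ n) (hq : 1 ≤ q ∧ q ≤ n) : SP n :=
  (σ.1 * Equiv.swap ⟨p - 1, by omega⟩ ⟨q - 1, by omega⟩, σ.2)

lemma swp_abs {n : ℕ} (σ : SP n) (p q : ℕ) (hp : 1 ≤ p ∧ p ≤ n) (hq : 1 ≤ q ∧ q ≤ n)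
    (i : ℕ) (hi : 1 ≤ i ∧ i ≤ n) :
    |sval (swp σ p q hp hq) i| = |sval σ (Equiv.swap p q i)| := by
  have h : 1 ≤ Equiv.swap p q i ∧ Equiv.swap p q i ≤ n := by
    rw [Equiv.swap_apply_def]; split_ifs <;> omega
  rw [abs_sval _ hi, abs_sval _ h]
  congr 3
  simp only [swp, Equiv.Perm.mul_apply]
  congr 1
  simp only [Equiv.swap_apply_def, Fin.mk.injEq]
  split_ifs <;> first | rfl | omega

lemma swp_pos {n : ℕ} (σ : SP n) (p q : ℕ) (hp : 1 ≤ p ∧ p ≤ n) (hq : 1 ≤ q ∧ q ≤ n)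
    (i : ℕ) (hi : 1 ≤ i ∧ i ≤ n) :
    0 < sval (swp σ p q hp hq) i ↔ 0 < sval σ i := by
  rw [sval_pos _ hi, sval_pos _ hi]; rfl

lemma eq_of_abs_pos {x y : ℤ} (h : |x| = |y|) (h2 : 0 < x ↔ 0 < y) : x = y := by
  rcases abs_cases x with ⟨h1, h2⟩ | ⟨h1, h2⟩ <;> rcases abs_cases y with ⟨h3, h4⟩ | ⟨h3, h4⟩ <;>
    omega

lemma swp_off {n : ℕ} (σ : SP n) (p q : ℕ) (hp : 1 ≤ p ∧ p ≤ n) (hq : 1 ≤ q ∧ q ≤ n)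
    (i : ℕ) (h1 : i ≠ p) (h2 : i ≠ q) : sval (swp σ p q hp hq) i = sval σ i := by
  by_cases hi : 1 ≤ i ∧ i ≤ n
  · refine eq_of_abs_pos ?_ (swp_pos σ p q hp hq i hi)
    rw [swp_abs σ p q hp hq i hi, Equiv.swap_apply_of_ne_of_ne h1 h2]
  · unfold sval; rw [dif_neg hi, dif_neg hi]

lemma swp_swp {n : ℕ} (σ : SP n) (p q : ℕ) (hp : 1 ≤ p ∧ p ≤ n) (hq : 1 ≤ q ∧ q ≤ n) :
    swp (swp σ p q hp hq) p q hp hq = σ := by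
  unfold swp
  simp [mul_assoc]

/-- flip signs at positions `1` and `q` -/
def flp {n : ℕ} (σ : SP n) (q : ℕ) : SP n :=
  (σ.1, fun i => if i.1 = 0 ∨ i.1 + 1 = q then !σ.2 i else σ.2 i)

lemma flp_sval {n : ℕ} (σ : SP n) (q : ℕ) (i : ℕ) :
    sval (flp σ q) i = if i = 1 ∨ i = q then - sval σ i else sval σ i := by
  unfold sval
  by_cases hi : 1 ≤ i ∧ i ≤ n
  · simp only [dif_pos hi, flp]
    have h : (i - 1 = 0 ∨ i - 1 + 1 = q) ↔ (i = 1 ∨ i = q) := by omega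
    simp only [h]
    by_cases h2 : i = 1 ∨ i = q
    · simp only [if_pos h2]
      cases σ.2 ⟨i - 1, by omega⟩ <;> simp
    · simp only [if_neg h2]
  · simp [dif_neg hi]

lemma flp_flp {n : ℕ} (σ : SP n) (q : ℕ) : flp (flp σ q) q = σ := by
  unfold flp
  refine Prod.ext rfl ?_
  funext i
  simp only
  split_ifs <;> simp

lemma flp_even {n : ℕ} (σ : SP n) (q : ℕ) (hq : 2 ≤ q) (hqn : q ≤ n) (h : IsEvenSP σ) :
    IsEvenSP (flp σ q) := by
  unfold IsEvenSP at *
  have hprod : ∀ e : Fin n → Bool, (∏ i, (if e i = true then (-1 : ℤ) else 1))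
      = (-1) ^ (Finset.univ.filter (fun i => e i = true)).card := by
    intro e
    rw [← Finset.prod_filter, Finset.prod_const]
  have hev : ∀ k : ℕ, Even k ↔ (-1 : ℤ) ^ k = 1 := fun k =>
    (neg_one_pow_eq_one_iff_even (by norm_num)).symm
  rw [hev, ← hprod] at h ⊢
  have hz : (⟨0, by omega⟩ : Fin n) ≠ ⟨q - 1, by omega⟩ := by
    intro h; rw [Fin.mk.injEq] at h; omega
  have : ∀ i : Fin n, (if (flp σ q).2 i = true then (-1 : ℤ) else 1)
      = (if σ.2 i = true then (-1 : ℤ) else 1) *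
        ((if i = ⟨0, by omega⟩ then -1 else 1) * (if i = ⟨q - 1, by omega⟩ then -1 else 1)) := by
    intro i
    have hfl : (flp σ q).2 i = if i.1 = 0 ∨ i.1 + 1 = q then !σ.2 i else σ.2 i := rfl
    simp only [Fin.ext_iff]
    by_cases h1 : i.1 = 0
    · have h2 : ¬ (i.1 = q - 1) := by omega
      rw [if_pos (Or.inl h1)] at hfl
      simp only [hfl, if_pos h1, if_neg h2]
      cases σ.2 i <;> simp
    · by_cases h2 : i.1 = q - 1
      · rw [if_pos (Or.inr (by omega))] at hfl
        simp only [hfl, if_neg h1, if_pos h2]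
        cases σ.2 i <;> simp
      · rw [if_neg (by omega)] at hfl
        simp only [hfl, if_neg h1, if_neg h2]
        simp
  rw [Finset.prod_congr rfl (fun i _ => this i), Finset.prod_mul_distrib, Finset.prod_mul_distrib, h]
  simp

lemma inQuot_iff_s15 {n m : ℕ} {I : Finset ℕ} (σ : SP n) (hm : 2 ≤ m)
    (hcomp : Finset.Icc 0 (m - 1) ⊆ I) (hout : m ∉ I) (hout1 : m + 1 ∉ I) :
    InQuot σ I ↔ Chain m (sval σ) ∧ ∀ i ∈ I, m + 1 < i → sval σ i < sval σ (i + 1) := by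
  constructor
  · intro h
    refine ⟨?_, ?_⟩
    · have h0 := h 0 (hcomp (by simp))
      have hs : ∀ i, 1 ≤ i → i < m → sval σ i < sval σ (i + 1) := by
        intro i h1 h2
        have := h i (hcomp (by simp; omega))
        simpa [dval, show i ≠ 0 by omega] using this
      have h1 := hs 1 le_rfl (by omega)
      simp only [dval] at h0
      norm_num at h0 h1
      have hb : |sval σ 1| < sval σ 2 := by rw [abs_lt]; omega
      intro j
      induction j with
      | zero => intro _ i _ h; omega
      | succ j ih =>
        intro hj i hi hij
        by_cases hj1 : j = 1
        · subst hj1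
          have : i = 1 := by omega
          subst this; exact hb
        · have hstep := hs j (by omega) (by omega)
          by_cases hij' : i = j
          · subst hij'
            have := ih (by omega) 1 le_rfl (by omega)
            have := abs_nonneg (sval σ 1)
            rw [abs_of_nonneg (by omega)]; exact hstep
          · exact (ih (by omega) i hi (by omega)).trans hstep
    · intro i hi h2
      have := h i hi
      simpa [dval, show i ≠ 0 by omega] using this
  · rintro ⟨hc, hr⟩ i hi
    have him : i ≠ m := by rintro rfl; exact hout hi
    have him' : i ≠ m + 1 := by rintro rfl; exact hout1 hi
    rcases Nat.eq_zero_or_pos i with rfl | hpos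
    · have := hc 2 hm 1 le_rfl (by omega)
      rw [abs_lt] at this
      simp [dval]; omega
    · simp only [dval, if_neg (show i ≠ 0 by omega), if_neg (show i + 1 ≠ 0 by omega)]
      by_cases hlt : i < m
      · exact (le_abs_self _).trans_lt (hc (i + 1) (by omega) i hpos (by omega))
      · exact hr i hi (by omega)

/-- the swap position -/
def IsP (m : ℕ) (s : ℕ → ℤ) (p : ℕ) : Prop :=
  p % 2 = 1 ∧ p < m ∧ (∀ i, 1 ≤ i → i < p → |s i| < |s (m + 1)|) ∧
    (∀ i, p < i → i ≤ m → |s (m + 1)| < |s i|)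

lemma isP_unique {m p p' : ℕ} {s : ℕ → ℤ} (h : IsP m s p) (h' : IsP m s p') : p = p' := by
  obtain ⟨a, b, c, d⟩ := h
  obtain ⟨a', b', c', d'⟩ := h'
  rcases lt_trichotomy p p' with hlt | heq | hgt
  · have h1 := c' (p + 1) (by omega) (by omega)
    have h2 := d (p + 1) (by omega) (by omega)
    omega
  · exact heq
  · have h1 := c (p' + 1) (by omega) (by omega)
    have h2 := d' (p' + 1) (by omega) (by omega)
    omega

lemma isP_exists {m : ℕ} {s : ℕ → ℤ} (hm : 2 ≤ m) (hme : Even m) (hc : Chain m s)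
    (hne : ∀ i, 1 ≤ i → i ≤ m → |s i| ≠ |s (m + 1)|) (hC : |s (m + 1)| < s m) :
    ∃ p, IsP m s p := by
  classical
  have hmono : ∀ i j, 1 ≤ i → i < j → j ≤ m → |s i| < |s j| := fun i j h1 h2 h3 =>
    (hc j h3 i h1 h2).trans_le (le_abs_self _)
  obtain ⟨t, rfl⟩ := hme
  have hex : ∃ k, |s (t + t + 1)| < |s (2 * k + 2)| := by
    refine ⟨t - 1, ?_⟩
    rw [show 2 * (t - 1) + 2 = t + t by omega]
    exact hC.trans_le (le_abs_self _)
  have hle : Nat.find hex ≤ t - 1 := by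
    apply Nat.find_min'
    rw [show 2 * (t - 1) + 2 = t + t by omega]
    exact hC.trans_le (le_abs_self _)
  have hspec := Nat.find_spec hex
  have hmin := fun k => @Nat.find_min _ _ hex k
  generalize Nat.find hex = k at *
  refine ⟨2 * k + 1, by omega, by omega, ?_, ?_⟩
  · intro i h1 h2
    have h3 := hmin (k - 1) (by omega)
    rw [show 2 * (k - 1) + 2 = 2 * k by omega] at h3
    have h4 := hne (2 * k) (by omega) (by omega)
    rcases Nat.lt_or_ge i (2 * k) with h | h
    · have := hmono i (2 * k) h1 h (by omega); omega
    · rw [show i = 2 * k by omega]; omega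
  · intro i h1 h2
    rcases Nat.lt_or_ge (2 * k + 2) i with h | h
    · exact hspec.trans (hmono _ _ (by omega) h h2)
    · rw [show i = 2 * k + 2 by omega]; exact hspec

lemma fpair_cases {x y y' : ℤ} (hs : 0 < y ↔ 0 < y')
    (h : (|x| < |y| ∧ |x| < |y'|) ∨ (|y| < |x| ∧ |y'| < |x|)) : fpair x y = fpair x y' := by
  rcases h with ⟨h1, h2⟩ | ⟨h1, h2⟩
  · by_cases hy : 0 < y
    · have hy' := hs.1 hy
      rw [abs_of_pos hy] at h1; rw [abs_of_pos hy'] at h2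
      rw [fpair_zero h1, fpair_zero h2]
    · have hy' : ¬ 0 < y' := fun h => hy (hs.2 h)
      rw [abs_of_nonpos (not_lt.1 hy)] at h1; rw [abs_of_nonpos (not_lt.1 hy')] at h2
      rw [fpair_two h1, fpair_two h2]
  · rw [fpair_one h1, fpair_one h2]

/-- All the facts about the swap involution. -/
lemma swp_facts {n m p : ℕ} {I : Finset ℕ} (σ : SP n) (hm : 2 ≤ m) (hmn : m + 1 ≤ n)
    (hme : Even m)
    (hcomp : Finset.Icc 0 (m - 1) ⊆ I) (hout : m ∉ I) (hout1 : m + 1 ∉ I)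
    (hQ : InQuot σ I) (hC : |sval σ (m + 1)| < sval σ m) (hP : IsP m (sval σ) p)
    (hp : 1 ≤ p ∧ p ≤ n) (hq : 1 ≤ m + 1 ∧ m + 1 ≤ n) :
    InQuot (swp σ p (m + 1) hp hq) I ∧
    |sval (swp σ p (m + 1) hp hq) (m + 1)| < sval (swp σ p (m + 1) hp hq) m ∧
    IsP m (sval (swp σ p (m + 1) hp hq)) p ∧
    LD (swp σ p (m + 1) hp hq) = LD σ ∧
    (-1 : Polynomial ℤ) ^ ellD (swp σ p (m + 1) hp hq) = - (-1) ^ ellD σ := by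
  rw [inQuot_iff_s15 σ hm hcomp hout hout1] at hQ
  rw [inQuot_iff_s15 _ hm hcomp hout hout1]
  have hoff := swp_off σ p (m + 1) hp hq
  have habs := swp_abs σ p (m + 1) hp hq
  have hpos := swp_pos σ p (m + 1) hp hq
  have hne := abs_sval_ne σ hp hq (by have := hP.2.1; omega)
  rw [ellD_eq, ellD_eq, LD_eq, LD_eq]
  generalize sval (swp σ p (m + 1) hp hq) = s' at *
  generalize sval σ = s at *
  obtain ⟨hc, hr⟩ := hQ
  obtain ⟨hp2, hpm, hlo, hhi⟩ := hP
  have ap : |s' p| = |s (m + 1)| := by rw [habs p hp, Equiv.swap_apply_left]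
  have aq : |s' (m + 1)| = |s p| := by rw [habs _ hq, Equiv.swap_apply_right]
  have hmono : ∀ i j, 1 ≤ i → i < j → j ≤ m → |s i| < |s j| := fun i j h1 h2 h3 =>
    (hc j h3 i h1 h2).trans_le (le_abs_self _)
  have hposm : ∀ i, 2 ≤ i → i ≤ m → 0 < s i := fun i h1 h2 =>
    (abs_nonneg _).trans_lt (hc i h2 1 le_rfl (by omega))
  have hc' : Chain m s' := by
    intro j hj i hi hij
    by_cases hjp : j = p
    · subst hjp
      have h0 : 0 < s' j := (hpos j hp).2 (hposm j (by omega) hj)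
      rw [hoff i (by omega) (by omega), ← abs_of_pos h0, ap]
      exact hlo i hi hij
    · rw [hoff j hjp (by omega)]
      by_cases hip : i = p
      · subst hip
        rw [ap, ← abs_of_pos (hposm j (by omega) hj)]
        exact hhi j hij hj
      · rw [hoff i hip (by omega)]
        exact hc j hj i hi hij
  have key : ∀ w : ℕ → ℕ → ℕ, (∀ j, w p j = w (m + 1) j) →
      wsum n w s + w p (m + 1) * fpair (s' p) (s' (m + 1))
      = wsum n w s' + w p (m + 1) * fpair (s p) (s (m + 1)) := by
    intro w hw
    refine wsum_swap hmn hp.1 hpm hw hc hc' (fun i h1 h2 => habs i ⟨h1, h2⟩)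
      (fun i hi => hoff i (by omega) (by omega)) ?_
    intro i h1 h2 h3
    rw [hoff i h3 (by omega)]
    refine fpair_cases (hpos _ hq) ?_
    rw [aq]
    rcases lt_or_gt_of_ne h3 with h | h
    · exact Or.inl ⟨hmono i p h1 h hpm.le, hlo i h1 h⟩
    · exact Or.inr ⟨hmono p i hp.1 h h2, hhi i h h2⟩
  obtain ⟨t, rfl⟩ := hme
  refine ⟨⟨hc', ?_⟩, ?_, ⟨hp2, hpm, ?_, ?_⟩, ?_, ?_⟩
  · intro i hi h
    rw [hoff i (by omega) (by omega), hoff (i + 1) (by omega) (by omega)]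
    exact hr i hi h
  · rw [aq, hoff (t + t) (by omega) (by omega)]
    exact hc _ le_rfl p hp.1 hpm
  · intro i h1 h2
    rw [aq, hoff i (by omega) (by omega)]
    exact hmono i p h1 h2 hpm.le
  · intro i h1 h2
    rw [aq, hoff i (by omega) (by omega)]
    exact hmono p i hp.1 h1 h2
  · have := key ow (fun j => by unfold ow; rw [show (t + t + 1) % 2 = p % 2 by omega])
    have h0 : ow p (t + t + 1) = 0 := by
      unfold ow; rw [if_neg]; rw [show (t + t + 1) % 2 = p % 2 by omega]; simp
    rw [h0] at this
    omega
  · have h1 := key (fun _ _ => 1) (fun _ => rfl)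
    have hfl : Odd (fpair (s' p) (s' (t + t + 1)) + fpair (s p) (s (t + t + 1))) := by
      rcases lt_or_gt_of_ne hne with h | h
      · rw [fpair_one (by rw [ap, aq]; exact h)]
        by_cases h0 : 0 < s (t + t + 1)
        · rw [fpair_zero (by rwa [abs_of_pos h0] at h)]; decide
        · rw [fpair_two (by rwa [abs_of_nonpos (not_lt.1 h0)] at h)]; decide
      · rw [fpair_one (x := s p) h]
        rw [← ap, ← aq] at h
        by_cases h0 : 0 < s' (t + t + 1)
        · rw [fpair_zero (by rwa [abs_of_pos h0] at h)]; decide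
        · rw [fpair_two (by rwa [abs_of_nonpos (not_lt.1 h0)] at h)]; decide
    simp only [one_mul] at h1
    have hodd : Odd (wsum n (fun _ _ => 1) s' + wsum n (fun _ _ => 1) s) := by
      rw [Nat.odd_iff] at hfl ⊢; omega
    generalize wsum n (fun _ _ => 1) s' = a at *
    generalize wsum n (fun _ _ => 1) s = b at *
    rcases Nat.even_or_odd a with ha | ha <;> rcases Nat.even_or_odd b with hb | hb
    · exact absurd hodd (Nat.not_odd_iff_even.2 (ha.add hb))
    · rw [ha.neg_one_pow, hb.neg_one_pow, neg_neg]
    · rw [ha.neg_one_pow, hb.neg_one_pow]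
    · exact absurd hodd (Nat.not_odd_iff_even.2 (ha.add_odd hb))

/-- chain-type facts for the sign flip -/
lemma flp_inQuot {n m : ℕ} {I : Finset ℕ} (σ : SP n) (hm : 2 ≤ m)
    (hcomp : Finset.Icc 0 (m - 1) ⊆ I) (hout : m ∉ I) (hout1 : m + 1 ∉ I)
    (hQ : InQuot σ I) : InQuot (flp σ (m + 1)) I := by
  rw [inQuot_iff_s15 _ hm hcomp hout hout1] at hQ ⊢
  refine ⟨?_, ?_⟩
  · intro j hj i hi hij
    rw [flp_sval, flp_sval, if_neg (by omega : ¬ (j = 1 ∨ j = m + 1))]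
    have := hQ.1 j hj i hi hij
    split_ifs
    · rwa [abs_neg]
    · exact this
  · intro i hi h
    rw [flp_sval, flp_sval, if_neg (by omega), if_neg (by omega)]
    exact hQ.2 i hi h

lemma flp_stats {n m : ℕ} {I : Finset ℕ} (σ : SP n) (hm : 2 ≤ m) (hmn : m + 1 ≤ n)
    (hme : Even m)
    (hcomp : Finset.Icc 0 (m - 1) ⊆ I) (hout : m ∉ I) (hout1 : m + 1 ∉ I)
    (hQ : InQuot σ I) (hA : sval σ m < sval σ (m + 1)) :
    LD (flp σ (m + 1)) = LD σ + m ∧ (-1 : Polynomial ℤ) ^ ellD (flp σ (m + 1)) = (-1) ^ ellD σ := by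
  have hQ' := flp_inQuot σ hm hcomp hout hout1 hQ
  rw [inQuot_iff_s15 _ hm hcomp hout hout1] at hQ hQ'
  have key : ∀ w : ℕ → ℕ → ℕ, wsum n w (sval (flp σ (m + 1)))
      = wsum n w (sval σ) + 2 * ∑ i ∈ Finset.Icc 1 m, w i (m + 1) := by
    intro w
    refine wsum_flip hmn hQ.1 hQ'.1 ?_ ?_ ?_ ?_
    · intro i _ _
      rw [flp_sval]; split_ifs <;> simp
    · intro i hi
      rw [flp_sval, if_neg (by omega)]
    · intro i h1 h2
      rcases Nat.lt_or_ge i m with h | h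
      · exact (hQ.1 m le_rfl i h1 h).trans hA
      · have : i = m := by omega
        subst this
        have h0 := (abs_nonneg _).trans_lt (hQ.1 i le_rfl 1 le_rfl (by omega))
        rwa [abs_of_pos h0]
    · rw [flp_sval, if_pos (Or.inr rfl)]
  constructor
  · rw [LD_eq, LD_eq, key, ow_sum hme]
  · rw [ellD_eq, ellD_eq, key, pow_add, pow_mul]; simp

/-- Lemma 3.3(1): if the connected component of `I` containing `0` is `[0,a₀-1]` with
`a₀` even, `a₀ ∈ [2,n-1]` and `a₀+1 ∉ I`, then
`D_n^I(x) = (1 + x^{a₀}) D_n^{I ∪ {a₀}}(x)`. -/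
theorem stmt15 (n a0 : ℕ) (I : Finset ℕ) (hI : I ⊆ Finset.range n)
    (ha0 : 2 ≤ a0) (ha0' : a0 ≤ n - 1) (ha0even : Even a0)
    (hcomp : Finset.Icc 0 (a0 - 1) ⊆ I) (hout : a0 ∉ I) (hout1 : a0 + 1 ∉ I) :
    genD n I = (1 + X ^ a0) * genD n (insert a0 I) := by
  classical
  have hmn : a0 + 1 ≤ n := by omega
  have hq : 1 ≤ a0 + 1 ∧ a0 + 1 ≤ n := by omega
  have hpos : ∀ σ : SP n, InQuot σ I → 0 < sval σ a0 := fun σ h =>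
    (abs_nonneg _).trans_lt
      (((inQuot_iff_s15 σ ha0 hcomp hout hout1).1 h).1 a0 le_rfl 1 le_rfl (by omega))
  set F : SP n → Polynomial ℤ := fun σ => (-1 : Polynomial ℤ) ^ ellD σ * X ^ LD σ with hF
  set Q := Finset.univ.filter (fun σ : SP n => IsEvenSP σ ∧ InQuot σ I) with hQdef
  have hA : genD n (insert a0 I) = ∑ σ ∈ Q.filter (fun σ => sval σ a0 < sval σ (a0 + 1)), F σ := by
    unfold genD
    refine Finset.sum_congr ?_ fun _ _ => rfl
    ext σ
    simp only [hQdef, Finset.mem_filter, Finset.mem_univ, true_and]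
    have : dval σ a0 < dval σ (a0 + 1) ↔ sval σ a0 < sval σ (a0 + 1) := by
      simp [dval, show a0 ≠ 0 by omega]
    have h2 : InQuot σ (insert a0 I) ↔ sval σ a0 < sval σ (a0 + 1) ∧ InQuot σ I := by
      rw [← this]
      unfold InQuot
      exact Finset.forall_mem_insert _ _ _
    rw [h2]
    tauto
  have hI' : genD n I = ∑ σ ∈ Q, F σ := rfl
  -- the cancelling part
  have hCzero : ∑ σ ∈ Q.filter (fun σ => |sval σ (a0 + 1)| < sval σ a0), F σ = 0 := by
    have hex : ∀ σ ∈ Q.filter (fun σ => |sval σ (a0 + 1)| < sval σ a0),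
        ∃ p, IsP a0 (sval σ) p := by
      intro σ hσ
      simp only [hQdef, Finset.mem_filter, Finset.mem_univ, true_and] at hσ
      exact isP_exists ha0 ha0even ((inQuot_iff_s15 σ ha0 hcomp hout hout1).1 hσ.1.2).1
        (fun i h1 h2 => abs_sval_ne σ ⟨h1, by omega⟩ hq (by omega)) hσ.2
    choose P hP using hex
    have hPr : ∀ σ hσ, 1 ≤ P σ hσ ∧ P σ hσ ≤ n := by
      intro σ hσ
      have := hP σ hσ
      have h1 := this.1
      have h2 := this.2.1
      omega
    have hfacts := fun σ (hσ : σ ∈ Q.filter (fun σ => |sval σ (a0 + 1)| < sval σ a0)) =>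
      swp_facts σ ha0 hmn ha0even hcomp hout hout1 (Finset.mem_filter.1 (Finset.mem_filter.1 hσ).1).2.2
        (Finset.mem_filter.1 hσ).2 (hP σ hσ) (hPr σ hσ) hq
    have hmem : ∀ σ hσ, swp σ (P σ hσ) (a0 + 1) (hPr σ hσ) hq
        ∈ Q.filter (fun σ => |sval σ (a0 + 1)| < sval σ a0) := by
      intro σ hσ
      refine Finset.mem_filter.2 ⟨Finset.mem_filter.2 ⟨Finset.mem_univ _, ?_, (hfacts σ hσ).1⟩,
        (hfacts σ hσ).2.1⟩
      exact (Finset.mem_filter.1 (Finset.mem_filter.1 hσ).1).2.1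
    refine Finset.sum_involution (fun σ hσ => swp σ (P σ hσ) (a0 + 1) (hPr σ hσ) hq) ?_ ?_ hmem ?_
    · intro σ hσ
      obtain ⟨-, -, -, h4, h5⟩ := hfacts σ hσ
      simp only [hF]
      rw [h4, h5]
      ring
    · intro σ hσ _ heq
      have h1 := swp_abs σ (P σ hσ) (a0 + 1) (hPr σ hσ) hq (a0 + 1) hq
      rw [heq, Equiv.swap_apply_right] at h1
      have := (hP σ hσ).2.1
      exact abs_sval_ne σ hq (hPr σ hσ) (by omega) h1
    · intro σ hσ
      have h3 := (hfacts σ hσ).2.2.1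
      have hu := isP_unique (hP _ (hmem σ hσ)) h3
      simp only [hu]
      exact swp_swp _ _ _ _ _
  -- the flipped part
  have hB : ∑ σ ∈ Q.filter (fun σ => sval σ (a0 + 1) < - sval σ a0), F σ
      = X ^ a0 * ∑ σ ∈ Q.filter (fun σ => sval σ a0 < sval σ (a0 + 1)), F σ := by
    rw [Finset.mul_sum]
    symm
    refine Finset.sum_bij' (fun σ _ => flp σ (a0 + 1)) (fun σ _ => flp σ (a0 + 1)) ?_ ?_ ?_ ?_ ?_
    · intro σ hσ
      simp only [hQdef, Finset.mem_filter, Finset.mem_univ, true_and] at hσ ⊢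
      refine ⟨⟨flp_even σ _ (by omega) hmn hσ.1.1, flp_inQuot σ ha0 hcomp hout hout1 hσ.1.2⟩, ?_⟩
      rw [flp_sval, flp_sval, if_pos (Or.inr rfl), if_neg (by omega)]
      linarith [hσ.2]
    · intro σ hσ
      simp only [hQdef, Finset.mem_filter, Finset.mem_univ, true_and] at hσ ⊢
      refine ⟨⟨flp_even σ _ (by omega) hmn hσ.1.1, flp_inQuot σ ha0 hcomp hout hout1 hσ.1.2⟩, ?_⟩
      rw [flp_sval, flp_sval, if_pos (Or.inr rfl), if_neg (by omega)]
      linarith [hσ.2]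
    · intro σ _; exact flp_flp σ _
    · intro σ _; exact flp_flp σ _
    · intro σ hσ
      simp only [hQdef, Finset.mem_filter, Finset.mem_univ, true_and] at hσ
      obtain ⟨h1, h2⟩ := flp_stats σ ha0 hmn ha0even hcomp hout hout1 hσ.1.2 hσ.2
      simp only [hF]
      rw [h1, h2, pow_add]
      ring
  have hsplit : ∑ σ ∈ Q, F σ = ∑ σ ∈ Q.filter (fun σ => sval σ a0 < sval σ (a0 + 1)), F σ
      + (∑ σ ∈ Q.filter (fun σ => sval σ (a0 + 1) < - sval σ a0), F σ
      + ∑ σ ∈ Q.filter (fun σ => |sval σ (a0 + 1)| < sval σ a0), F σ) := by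
    simp only [Finset.sum_filter]
    rw [← Finset.sum_add_distrib, ← Finset.sum_add_distrib]
    refine Finset.sum_congr rfl fun σ hσ => ?_
    have h0 := hpos σ (Finset.mem_filter.1 hσ).2.2
    have hne := abs_sval_ne σ (i := a0) (j := a0 + 1) ⟨by omega, by omega⟩ hq (by omega)
    rw [abs_of_pos h0] at hne
    rcases lt_trichotomy (|sval σ (a0 + 1)|) (sval σ a0) with h | h | h
    · have h' := abs_lt.1 h
      rw [if_neg (by omega), if_neg (by omega), if_pos h]; simp
    · exact absurd h.symm hne
    · rw [if_neg (not_lt.2 h.le : ¬ |sval σ (a0 + 1)| < sval σ a0)]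
      rcases lt_abs.1 h with h' | h'
      · rw [if_pos h', if_neg (by omega)]; simp
      · rw [if_neg (by omega), if_pos (by omega)]; simp
  rw [hA, hI', hsplit, hCzero, hB]
  ring

end OddLength
end
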